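/- Let (q₁, r₁) and (q₂, r₂) satisfy 3/qⱼ + 2/rⱼ = 1 and 2 ≤ rⱼ ≤ ∞ for j = 1, 2. Then there is a constant C such that for every t ∈ ℝ and every space-time function F, ‖ ∫_τ^∞ V(τ − τ′) F(τ′) dτ′ ‖_{L^{q₁}_τ(t,∞; L^{r₁}_x(ℝ²))} ≤ C ‖F‖_{L^{q₂′}_τ(t,∞; L^{r₂′}_x(ℝ²))}, where q₂′ and r₂′ are the Hölder conjugate exponents of q₂ and r₂. -/

import Mathlib

noncomputable section
open MeasureTheory Real Complex FourierTransform ENNReal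

/-- Two-dimensional Euclidean space. -/
abbrev E2 := EuclideanSpace ℝ (Fin 2)

/-- Fourier multiplier operator with symbol `m`. -/
def fmul (m : E2 → ℂ) (f : E2 → ℂ) : E2 → ℂ :=
  𝓕⁻ fun ξ => m ξ * 𝓕 f ξ

/-- The unitary group `V(t) = e^{-t(∂₁³+∂₂³)}`, Fourier multiplier with symbol
`e^{it(ξ₁³+ξ₂³)}`. -/
def Vop (t : ℝ) (f : E2 → ℂ) : E2 → ℂ :=
  fmul (fun ξ => Complex.exp (Complex.I * t * ((ξ 0 : ℂ) ^ 3 + (ξ 1 : ℂ) ^ 3))) f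

/-- `∂_{x_j}^{s}` : Fourier multiplier with symbol `(iξ_j)^s`. -/
def dpow (j : Fin 2) (s : ℝ) (f : E2 → ℂ) : E2 → ℂ :=
  fmul (fun ξ => (Complex.I * (ξ j : ℂ)) ^ (s : ℂ)) f

/-- `|∂_{x_j}|^{s}` : Fourier multiplier with symbol `|ξ_j|^s`. -/
def absD (j : Fin 2) (s : ℝ) (f : E2 → ℂ) : E2 → ℂ :=
  fmul (fun ξ => ((|ξ j| ^ s : ℝ) : ℂ)) f

/-- The weight `⟨x⟩ = √(1+|x|²)`. -/
def weight (f : E2 → ℂ) : E2 → ℂ :=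
  fun x => (Real.sqrt (1 + ‖x‖ ^ 2) : ℂ) * f x

/-- The inhomogeneous Sobolev norm `‖⟨∇⟩ˢ f‖_{L^p}`. -/
def sobNorm (s : ℝ) (p : ℝ≥0∞) (f : E2 → ℂ) : ℝ≥0∞ :=
  eLpNorm (fmul (fun ξ => (((1 + ‖ξ‖ ^ 2) ^ (s / 2) : ℝ) : ℂ)) f) p volume

/-- The norm `‖·‖_X`. -/
def Xnorm (f : E2 → ℂ) : ℝ≥0∞ :=
  sobNorm 3 1 (weight (dpow 0 (-(1/2)) (dpow 1 (-(1/2)) f)))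
  + sobNorm 3 2 (weight (dpow 0 (-1) f))
  + sobNorm 3 2 (weight (dpow 1 (-1) f))
  + sobNorm 3 2 (weight (dpow 0 1 (dpow 1 (-2) f)))
  + sobNorm 3 2 (weight (dpow 0 (-2) (dpow 1 1 f)))
  + sobNorm 3 2 (dpow 0 (-2) f)
  + sobNorm 3 2 (dpow 1 (-2) f)

/-- The norm `‖·‖_Z`. -/
def Znorm (f : E2 → ℂ) : ℝ≥0∞ :=
  eLpNorm (weight (dpow 0 (-(1/2)) (dpow 1 (-(1/2)) f))) 1 volume
  + eLpNorm (weight (dpow 0 (-1) f)) 2 volume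
  + eLpNorm (weight (dpow 1 (-1) f)) 2 volume
  + eLpNorm (weight (dpow 0 1 (dpow 1 (-2) f))) 2 volume
  + eLpNorm (weight (dpow 0 (-2) (dpow 1 1 f))) 2 volume
  + eLpNorm (dpow 0 (-2) f) 2 volume
  + eLpNorm (dpow 1 (-2) f) 2 volume

/-- The `L^q` norm (with values in `ℝ≥0∞`) of an `ℝ≥0∞`-valued function on `(t,∞)`. -/
def lqNormIoi (q : ℝ≥0∞) (t : ℝ) (h : ℝ → ℝ≥0∞) : ℝ≥0∞ :=
  if q = ∞ then essSup h (volume.restrict (Set.Ioi t))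
  else (∫⁻ τ in Set.Ioi t, h τ ^ q.toReal) ^ (1 / q.toReal)

/-- The mixed space-time norm `‖u‖_{L^q_τ(t,∞;L^r_x)}`. -/
def mixedNorm (q r : ℝ≥0∞) (t : ℝ) (u : ℝ → E2 → ℂ) : ℝ≥0∞ :=
  lqNormIoi q t fun τ => eLpNorm (u τ) r volume

theorem lintegral_even_eq {f : ℝ → ℝ≥0∞} (hf : ∀ x, f (-x) = f x) :
    ∫⁻ x, f x = 2 * ∫⁻ x in Set.Ioi 0, f x := by
  have h1 : ∫⁻ x in Set.Iic (0:ℝ), f x = ∫⁻ x in Set.Ioi (0:ℝ), f x := by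
    rw [← lintegral_indicator measurableSet_Iic, ← lintegral_neg_eq_self,
      ← lintegral_indicator measurableSet_Ioi]
    apply lintegral_congr_ae
    have : ∀ᵐ x : ℝ, x ≠ 0 := by simp [ae_iff]
    filter_upwards [this] with x hx
    by_cases h : 0 < x
    · rw [Set.indicator_of_mem (by simpa using h.le), Set.indicator_of_mem (by simpa using h), hf]
    · have : x < 0 := lt_of_le_of_ne (not_lt.1 h) hx
      rw [Set.indicator_of_notMem (by simpa using this), Set.indicator_of_notMem (by simpa using h)]
  rw [← lintegral_add_compl f (measurableSet_Ioi (a := (0:ℝ))), Set.compl_Ioi, h1, two_mul]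

theorem enorm_rpow_eq_ofReal {x : ℝ} (hx : 0 < x) (a : ℝ) :
    ‖x‖ₑ ^ a = ENNReal.ofReal (x ^ a) := by
  rw [Real.enorm_eq_ofReal hx.le, ENNReal.ofReal_rpow_of_pos hx]

theorem lintegral_near_le {δ : ℝ} (hδ : 0 < δ) (s : ℝ) :
    ∫⁻ t, {r : ℝ | ‖r‖ ≤ δ}.indicator (fun r => ‖r‖ₑ ^ (-(2/3) : ℝ)) (s - t)
      = ENNReal.ofReal (6 * δ ^ (1/3 : ℝ)) := by
  rw [lintegral_sub_left_eq_self, lintegral_even_eq]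
  · have h1 : ∫⁻ x in Set.Ioi (0:ℝ), {r : ℝ | ‖r‖ ≤ δ}.indicator (fun r => ‖r‖ₑ ^ (-(2/3) : ℝ)) x
        = ∫⁻ x in Set.Ioc 0 δ, ENNReal.ofReal (x ^ (-(2/3) : ℝ)) := by
      rw [← lintegral_indicator measurableSet_Ioi, ← lintegral_indicator measurableSet_Ioc]
      refine lintegral_congr fun x => ?_
      by_cases h : 0 < x <;> by_cases h' : x ≤ δ <;>
        simp [Set.indicator, h, h', abs_of_pos, enorm_rpow_eq_ofReal]
    rw [h1, ← ofReal_integral_eq_lintegral_ofReal]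
    · rw [← intervalIntegral.integral_of_le hδ.le, integral_rpow (by norm_num)]
      rw [Real.zero_rpow (by norm_num), show (2:ℝ≥0∞) = ENNReal.ofReal 2 by simp,
        ← ENNReal.ofReal_mul (by norm_num)]
      congr 1
      norm_num
      ring
    · have := intervalIntegral.intervalIntegrable_rpow' (a := 0) (b := δ)
        (show (-1 : ℝ) < -(2/3) by norm_num)
      rwa [intervalIntegrable_iff_integrableOn_Ioc_of_le hδ.le] at this
    · filter_upwards [ae_restrict_mem measurableSet_Ioc] with x hx
      exact Real.rpow_nonneg hx.1.le _
  · intro x; simp [Set.indicator]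

theorem lintegral_far_eq {δ : ℝ} (hδ : 0 < δ) (s : ℝ) :
    ∫⁻ t, {r : ℝ | δ < ‖r‖}.indicator (fun r => ‖r‖ₑ ^ (-2 : ℝ)) (s - t)
      = ENNReal.ofReal (2 / δ) := by
  rw [lintegral_sub_left_eq_self
    (fun x => {r : ℝ | δ < ‖r‖}.indicator (fun r => ‖r‖ₑ ^ (-2 : ℝ)) x), lintegral_even_eq]
  · have h1 : ∫⁻ x in Set.Ioi (0:ℝ), {r : ℝ | δ < ‖r‖}.indicator (fun r => ‖r‖ₑ ^ (-2 : ℝ)) x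
        = ∫⁻ x in Set.Ioi δ, ENNReal.ofReal (x ^ (-2 : ℝ)) := by
      rw [← lintegral_indicator measurableSet_Ioi, ← lintegral_indicator measurableSet_Ioi]
      refine lintegral_congr fun x => ?_
      by_cases h : 0 < x
      · by_cases h' : δ < x <;>
          simp [Set.indicator, h, h', abs_of_pos, enorm_rpow_eq_ofReal]
      · have : ¬ δ < x := fun h' => h (hδ.trans h')
        simp [Set.indicator, h, this]
    rw [h1, ← ofReal_integral_eq_lintegral_ofReal]
    · rw [integral_Ioi_rpow_of_lt (by norm_num) hδ, show (2:ℝ≥0∞) = ENNReal.ofReal 2 by simp,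
        ← ENNReal.ofReal_mul (by norm_num)]
      congr 1
      rw [show (-2 + 1 : ℝ) = -1 by norm_num, Real.rpow_neg_one]
      ring
    · exact integrableOn_Ioi_rpow_of_lt (by norm_num) hδ
    · filter_upwards [ae_restrict_mem measurableSet_Ioi] with x hx
      exact Real.rpow_nonneg (hδ.trans hx).le _
  · intro x; simp [Set.indicator]

/-- Half of the Hardy–Littlewood–Sobolev inequality: one fixed point against a density. -/
theorem lintegral_riesz_fixed_le {a : ℝ≥0∞} {B : ℝ → ℝ≥0∞} (hB : Measurable B)
    (hB1 : ∫⁻ t, B t ≤ 1) (s : ℝ) :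
    ∫⁻ t, {t | B t ≤ a}.indicator (fun t => a ^ (2/3 : ℝ) * B t ^ (2/3 : ℝ) *
      ‖s - t‖ₑ ^ (-(2/3) : ℝ)) t ≤ 8 * a := by
  rcases eq_or_ne a 0 with rfl | ha0
  · simp
  rcases eq_or_ne a ∞ with rfl | hat
  · simp [ENNReal.mul_top]
  lift a to NNReal using hat
  have hapos : 0 < (a : ℝ) := by
    have : a ≠ 0 := by simpa using ha0
    positivity
  set δ : ℝ := (a : ℝ)⁻¹ with hδ
  have hδpos : 0 < δ := by positivity
  have key : ∀ t, {t | B t ≤ a}.indicator (fun t => (a : ℝ≥0∞) ^ (2/3 : ℝ) * B t ^ (2/3 : ℝ) *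
      ‖s - t‖ₑ ^ (-(2/3) : ℝ)) t ≤
      (a : ℝ≥0∞) ^ (4/3 : ℝ) *
        {r : ℝ | ‖r‖ ≤ δ}.indicator (fun r => ‖r‖ₑ ^ (-(2/3) : ℝ)) (s - t)
      + (a : ℝ≥0∞) ^ (2/3 : ℝ) * (B t ^ (2/3 : ℝ) *
        ({r : ℝ | δ < ‖r‖}.indicator (fun r => ‖r‖ₑ ^ (-(2/3) : ℝ)) (s - t))) := by
    intro t
    by_cases hBt : B t ≤ a
    · rw [Set.indicator_of_mem (by exact hBt)]
      by_cases h : ‖s - t‖ ≤ δ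
      · rw [Set.indicator_of_mem (by exact h)]
        refine le_trans ?_ le_self_add
        gcongr
        calc _ ≤ (a : ℝ≥0∞) ^ (2/3 : ℝ) * (a : ℝ≥0∞) ^ (2/3 : ℝ) := by gcongr
          _ = _ := by rw [← ENNReal.rpow_add _ _ ha0 (by simp)]; norm_num
      · rw [Set.indicator_of_mem (s := {r : ℝ | δ < ‖r‖}) (by exact not_le.1 h), ← mul_assoc]
        exact le_add_self
    · rw [Set.indicator_of_notMem (by exact hBt)]
      exact zero_le
  refine (lintegral_mono key).trans ?_
  have hm1 : Measurable fun t : ℝ =>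
      {r : ℝ | ‖r‖ ≤ δ}.indicator (fun r => ‖r‖ₑ ^ (-(2/3) : ℝ)) (s - t) := by
    apply Measurable.comp (g := {r : ℝ | ‖r‖ ≤ δ}.indicator (fun r => ‖r‖ₑ ^ (-(2/3) : ℝ)))
    · exact Measurable.indicator (by fun_prop) (measurableSet_le (by fun_prop) (by fun_prop))
    · fun_prop
  have hm2 : Measurable fun t : ℝ =>
      {r : ℝ | δ < ‖r‖}.indicator (fun r => ‖r‖ₑ ^ (-(2/3) : ℝ)) (s - t) := by
    apply Measurable.comp (g := {r : ℝ | δ < ‖r‖}.indicator (fun r => ‖r‖ₑ ^ (-(2/3) : ℝ)))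
    · exact Measurable.indicator (by fun_prop) (measurableSet_lt (by fun_prop) (by fun_prop))
    · fun_prop
  rw [lintegral_add_left (by fun_prop), lintegral_const_mul _ hm1, lintegral_near_le hδpos,
    lintegral_const_mul _ (by fun_prop)]
  have hH := ENNReal.lintegral_mul_le_Lp_mul_Lq volume
    (Real.holderConjugate_iff.2 ⟨by norm_num, by norm_num⟩ : Real.HolderConjugate (3/2) 3)
    (f := fun t => B t ^ (2/3 : ℝ))
    (g := fun t => {r : ℝ | δ < ‖r‖}.indicator (fun r => ‖r‖ₑ ^ (-(2/3) : ℝ)) (s - t))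
    (by fun_prop) hm2.aemeasurable
  have e1 : ∫⁻ t, (B t ^ (2/3 : ℝ)) ^ (3/2 : ℝ) ≤ 1 := by
    simp_rw [← ENNReal.rpow_mul]; norm_num; exact hB1
  have e2 : ∫⁻ t, ({r : ℝ | δ < ‖r‖}.indicator (fun r => ‖r‖ₑ ^ (-(2/3) : ℝ)) (s - t)) ^ (3:ℝ)
      = ENNReal.ofReal (2 / δ) := by
    rw [← lintegral_far_eq hδpos s]
    refine lintegral_congr fun t => ?_
    by_cases h : δ < ‖s - t‖
    · rw [Set.indicator_of_mem (by exact h), Set.indicator_of_mem (by exact h),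
        ← ENNReal.rpow_mul]; norm_num
    · rw [Set.indicator_of_notMem (by exact h), Set.indicator_of_notMem (by exact h)]; simp
  rw [e2] at hH
  have hH2 : ∫⁻ t, B t ^ (2/3 : ℝ) *
      {r : ℝ | δ < ‖r‖}.indicator (fun r => ‖r‖ₑ ^ (-(2/3) : ℝ)) (s - t)
      ≤ ENNReal.ofReal (2 / δ) ^ (1 / 3 : ℝ) := by
    refine hH.trans ?_
    calc _ ≤ (1 : ℝ≥0∞) ^ (1 / (3/2) : ℝ) * ENNReal.ofReal (2 / δ) ^ (1 / 3 : ℝ) := by gcongr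
      _ = _ := by simp
  have haR : (a : ℝ≥0∞) = ENNReal.ofReal (a : ℝ) := by simp
  calc _ ≤ (a : ℝ≥0∞) ^ (4/3 : ℝ) * ENNReal.ofReal (6 * δ ^ (1/3 : ℝ)) +
        (a : ℝ≥0∞) ^ (2/3 : ℝ) * ENNReal.ofReal (2 / δ) ^ (1 / 3 : ℝ) := by gcongr
    _ ≤ 8 * a := by
      rw [haR, ENNReal.ofReal_rpow_of_pos hapos, ENNReal.ofReal_rpow_of_pos hapos,
        ENNReal.ofReal_rpow_of_pos (by positivity), ← ENNReal.ofReal_mul (by positivity),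
        ← ENNReal.ofReal_mul (by positivity), ← ENNReal.ofReal_add (by positivity) (by positivity),
        show (8 : ℝ≥0∞) = ENNReal.ofReal 8 by simp, ← ENNReal.ofReal_mul (by positivity)]
      apply ENNReal.ofReal_le_ofReal
      have i1 : δ ^ (1/3 : ℝ) = (a : ℝ) ^ (-(1/3) : ℝ) := by
        rw [hδ, Real.inv_rpow hapos.le, Real.rpow_neg hapos.le]
      have i2 : (2 / δ) ^ (1/3 : ℝ) = 2 ^ (1/3 : ℝ) * (a : ℝ) ^ (1/3 : ℝ) := by
        rw [hδ, div_inv_eq_mul, Real.mul_rpow (by norm_num) hapos.le]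
      have i3 : (a : ℝ) ^ (4/3 : ℝ) * (a : ℝ) ^ (-(1/3) : ℝ) = a := by
        rw [← Real.rpow_add hapos]; norm_num
      have i4 : (a : ℝ) ^ (2/3 : ℝ) * (a : ℝ) ^ (1/3 : ℝ) = a := by
        rw [← Real.rpow_add hapos]; norm_num
      have i5 : (2 : ℝ) ^ (1/3 : ℝ) ≤ 2 := by
        calc (2 : ℝ) ^ (1/3 : ℝ) ≤ 2 ^ (1:ℝ) :=
              Real.rpow_le_rpow_of_exponent_le (by norm_num) (by norm_num)
          _ = 2 := by simp
      rw [i1, i2]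
      calc _ = 6 * ((a : ℝ) ^ (4/3 : ℝ) * (a : ℝ) ^ (-(1/3) : ℝ)) +
            2 ^ (1/3 : ℝ) * ((a : ℝ) ^ (2/3 : ℝ) * (a : ℝ) ^ (1/3 : ℝ)) := by ring
        _ ≤ 8 * a := by rw [i3, i4]; nlinarith

theorem lintegral_riesz_normalized_le {A B : ℝ → ℝ≥0∞} (hA : Measurable A) (hB : Measurable B)
    (hA1 : ∫⁻ t, A t ≤ 1) (hB1 : ∫⁻ t, B t ≤ 1) :
    ∫⁻ s, ∫⁻ t, A s ^ (2/3 : ℝ) * B t ^ (2/3 : ℝ) * ‖s - t‖ₑ ^ (-(2/3) : ℝ) ≤ 16 := by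
  have hmA : Measurable fun p : ℝ × ℝ => {p : ℝ × ℝ | A p.1 ≤ B p.2}.indicator
      (fun p => A p.1 ^ (2/3 : ℝ) * B p.2 ^ (2/3 : ℝ) * ‖p.1 - p.2‖ₑ ^ (-(2/3) : ℝ)) p :=
    Measurable.indicator (by fun_prop) (measurableSet_le (by fun_prop) (by fun_prop))
  have hmB : Measurable fun p : ℝ × ℝ => {p : ℝ × ℝ | B p.2 ≤ A p.1}.indicator
      (fun p => A p.1 ^ (2/3 : ℝ) * B p.2 ^ (2/3 : ℝ) * ‖p.1 - p.2‖ₑ ^ (-(2/3) : ℝ)) p :=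
    Measurable.indicator (by fun_prop) (measurableSet_le (by fun_prop) (by fun_prop))
  have hs : ∀ s t, A s ^ (2/3 : ℝ) * B t ^ (2/3 : ℝ) * ‖s - t‖ₑ ^ (-(2/3) : ℝ) ≤
      {p : ℝ × ℝ | B p.2 ≤ A p.1}.indicator
        (fun p => A p.1 ^ (2/3 : ℝ) * B p.2 ^ (2/3 : ℝ) * ‖p.1 - p.2‖ₑ ^ (-(2/3) : ℝ)) (s, t) +
      {p : ℝ × ℝ | A p.1 ≤ B p.2}.indicator
        (fun p => A p.1 ^ (2/3 : ℝ) * B p.2 ^ (2/3 : ℝ) * ‖p.1 - p.2‖ₑ ^ (-(2/3) : ℝ)) (s, t) := by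
    intro s t
    rcases le_total (B t) (A s) with h | h
    · rw [Set.indicator_of_mem (by exact h)]; exact le_self_add
    · rw [Set.indicator_of_mem (s := {p : ℝ × ℝ | A p.1 ≤ B p.2}) (by exact h)]
      exact le_add_self
  calc _ ≤ ∫⁻ s, ∫⁻ t, ({p : ℝ × ℝ | B p.2 ≤ A p.1}.indicator
        (fun p => A p.1 ^ (2/3 : ℝ) * B p.2 ^ (2/3 : ℝ) * ‖p.1 - p.2‖ₑ ^ (-(2/3) : ℝ)) (s, t) +
      {p : ℝ × ℝ | A p.1 ≤ B p.2}.indicator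
        (fun p => A p.1 ^ (2/3 : ℝ) * B p.2 ^ (2/3 : ℝ) * ‖p.1 - p.2‖ₑ ^ (-(2/3) : ℝ)) (s, t)) := by
        gcongr with s t; exact hs s t
    _ = (∫⁻ s, ∫⁻ t, {p : ℝ × ℝ | B p.2 ≤ A p.1}.indicator
        (fun p => A p.1 ^ (2/3 : ℝ) * B p.2 ^ (2/3 : ℝ) * ‖p.1 - p.2‖ₑ ^ (-(2/3) : ℝ)) (s, t)) +
      ∫⁻ t, ∫⁻ s, {p : ℝ × ℝ | A p.1 ≤ B p.2}.indicator
        (fun p => A p.1 ^ (2/3 : ℝ) * B p.2 ^ (2/3 : ℝ) * ‖p.1 - p.2‖ₑ ^ (-(2/3) : ℝ)) (s, t) := by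
        rw [← lintegral_lintegral_swap (f := fun s t => {p : ℝ × ℝ | A p.1 ≤ B p.2}.indicator
          (fun p => A p.1 ^ (2/3 : ℝ) * B p.2 ^ (2/3 : ℝ) * ‖p.1 - p.2‖ₑ ^ (-(2/3) : ℝ)) (s, t))
          hmA.aemeasurable, ← lintegral_add_left hmB.lintegral_prod_right']
        exact lintegral_congr fun s => lintegral_add_left (hmB.comp measurable_prodMk_left) _
    _ ≤ (∫⁻ s, 8 * A s) + ∫⁻ t, 8 * B t := by
        gcongr with s t
        · exact lintegral_riesz_fixed_le hB hB1 s
        · refine le_trans (lintegral_mono fun s => ?_) (lintegral_riesz_fixed_le hA hA1 t)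
          simp only [Set.indicator, Set.mem_ofPred_eq]
          split_ifs
          · rw [mul_comm (A s ^ _), ← enorm_neg (t - s), neg_sub]
          · exact le_rfl
    _ ≤ 8 * 1 + 8 * 1 := by
        rw [lintegral_const_mul _ hA, lintegral_const_mul _ hB]
        gcongr
    _ = 16 := by norm_num

/-- The Hardy–Littlewood–Sobolev inequality on the line for the kernel `|s - t|^{-2/3}`. -/
theorem lintegral_riesz_le {f g : ℝ → ℝ≥0∞} (hf : Measurable f) (hg : Measurable g) :
    ∫⁻ s, ∫⁻ t, f s * g t * ‖s - t‖ₑ ^ (-(2/3) : ℝ) ≤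
      16 * ((∫⁻ t, f t ^ (3/2 : ℝ)) ^ (2/3 : ℝ) * (∫⁻ t, g t ^ (3/2 : ℝ)) ^ (2/3 : ℝ)) := by
  set α := ∫⁻ t, f t ^ (3/2 : ℝ) with hα
  set β := ∫⁻ t, g t ^ (3/2 : ℝ) with hβ
  have zero_case : ∀ h : ℝ → ℝ≥0∞, Measurable h → ∫⁻ t, h t ^ (3/2 : ℝ) = 0 → h =ᵐ[volume] 0 := by
    intro h hm h0
    rw [lintegral_eq_zero_iff (by fun_prop)] at h0
    filter_upwards [h0] with t ht
    have h32 : ¬ (3/2 : ℝ) < 0 := by norm_num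
    simpa [h32] using ht
  rcases eq_or_ne α 0 with h0 | h0
  · have := zero_case f hf h0
    refine le_trans (le_of_eq ?_) zero_le
    rw [lintegral_eq_zero_iff' (by fun_prop)]
    filter_upwards [this] with s hs
    simp [hs]
  rcases eq_or_ne β 0 with h1 | h1
  · have := zero_case g hg h1
    refine le_trans (le_of_eq ?_) zero_le
    have : ∀ s, ∫⁻ t, f s * g t * ‖s - t‖ₑ ^ (-(2/3) : ℝ) = 0 := by
      intro s
      rw [lintegral_eq_zero_iff (by fun_prop)]
      filter_upwards [this] with t ht
      simp [ht]
    simp [this]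
  rcases eq_or_ne α ∞ with h2 | h2
  · rw [h2]
    have : β ^ (2/3 : ℝ) ≠ 0 := fun h => h1 ((ENNReal.rpow_eq_zero_iff_of_pos (by norm_num)).1 h)
    rw [ENNReal.top_rpow_of_pos (by norm_num), ENNReal.top_mul this, ENNReal.mul_top (by norm_num)]
    exact le_top
  rcases eq_or_ne β ∞ with h3 | h3
  · rw [h3]
    have : α ^ (2/3 : ℝ) ≠ 0 := fun h => h0 ((ENNReal.rpow_eq_zero_iff_of_pos (by norm_num)).1 h)
    rw [ENNReal.top_rpow_of_pos (by norm_num), ENNReal.mul_top this, ENNReal.mul_top (by norm_num)]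
    exact le_top
  have norm : ∀ (h : ℝ → ℝ≥0∞) (γ : ℝ≥0∞), Measurable h → ∫⁻ t, h t ^ (3/2 : ℝ) = γ → γ ≠ 0 →
      γ ≠ ∞ → ∫⁻ t, γ⁻¹ * h t ^ (3/2 : ℝ) ≤ 1 ∧
        ∀ t, h t = γ ^ (2/3 : ℝ) * (γ⁻¹ * h t ^ (3/2 : ℝ)) ^ (2/3 : ℝ) := by
    intro h γ hm hγ hγ0 hγt
    refine ⟨?_, fun t => ?_⟩
    · rw [lintegral_const_mul _ (by fun_prop), hγ, ENNReal.inv_mul_cancel hγ0 hγt]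
    · rw [← ENNReal.mul_rpow_of_nonneg _ _ (by norm_num), ← mul_assoc,
        ENNReal.mul_inv_cancel hγ0 hγt, one_mul, ← ENNReal.rpow_mul]
      norm_num
  obtain ⟨nf, ef⟩ := norm f α hf rfl h0 h2
  obtain ⟨ng, eg⟩ := norm g β hg rfl h1 h3
  have := lintegral_riesz_normalized_le (by fun_prop) (by fun_prop) nf ng
  calc _ = ∫⁻ s, ∫⁻ t, (α ^ (2/3 : ℝ) * β ^ (2/3 : ℝ)) * ((α⁻¹ * f s ^ (3/2 : ℝ)) ^ (2/3 : ℝ) *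
        (β⁻¹ * g t ^ (3/2 : ℝ)) ^ (2/3 : ℝ) * ‖s - t‖ₑ ^ (-(2/3) : ℝ)) := by
        refine lintegral_congr fun s => lintegral_congr fun t => ?_
        conv_lhs => rw [ef s, eg t]
        ring
    _ = (α ^ (2/3 : ℝ) * β ^ (2/3 : ℝ)) * ∫⁻ s, ∫⁻ t, ((α⁻¹ * f s ^ (3/2 : ℝ)) ^ (2/3 : ℝ) *
        (β⁻¹ * g t ^ (3/2 : ℝ)) ^ (2/3 : ℝ) * ‖s - t‖ₑ ^ (-(2/3) : ℝ)) := by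
        rw [← lintegral_const_mul _ (by fun_prop)]
        refine lintegral_congr fun s => ?_
        rw [lintegral_const_mul _ (by fun_prop)]
    _ ≤ _ := by
        rw [mul_comm 16]
        gcongr

/-- Van der Corput's first derivative estimate for a cubic phase. -/
theorem norm_integral_cubic_phase_le {a c b s δ : ℝ} (hδ : 0 < δ) (ha : 0 ≤ a) (hac : a ≤ c)
    (hs : 0 < s) (hp : ∀ ξ ∈ Set.Icc a c, δ ≤ |b + 3 * s * ξ ^ 2|) :
    ‖∫ ξ in a..c, Complex.exp (((b * ξ + s * ξ ^ 3 : ℝ) : ℂ) * I)‖ ≤ 4 / δ := by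
  have hIcc : Set.uIcc a c = Set.Icc a c := Set.uIcc_of_le hac
  have hne : ∀ ξ ∈ Set.Icc a c, b + 3 * s * ξ ^ 2 ≠ 0 := fun ξ hξ h0 => by
    have := hp ξ hξ
    rw [h0, abs_zero] at this
    linarith
  have hneC : ∀ ξ ∈ Set.Icc a c, ((b + 3 * s * ξ ^ 2 : ℝ) : ℂ) ≠ 0 := fun ξ hξ =>
    Complex.ofReal_ne_zero.2 (hne ξ hξ)
  have hd1 : ∀ ξ : ℝ, HasDerivAt (fun ξ : ℝ => b * ξ + s * ξ ^ 3) (b + 3 * s * ξ ^ 2) ξ := by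
    intro ξ
    have := ((hasDerivAt_id ξ).const_mul b).add (((hasDerivAt_id ξ).pow 3).const_mul s)
    refine this.congr_deriv ?_
    simp; ring
  have hd2 : ∀ ξ : ℝ, HasDerivAt (fun ξ : ℝ => b + 3 * s * ξ ^ 2) (6 * s * ξ) ξ := by
    intro ξ
    have := (((hasDerivAt_id ξ).pow 2).const_mul (3 * s)).const_add b
    refine this.congr_deriv ?_
    simp; ring
  have hde : ∀ ξ : ℝ, HasDerivAt (fun ξ : ℝ => Complex.exp (((b * ξ + s * ξ ^ 3 : ℝ) : ℂ) * I))
      (Complex.exp (((b * ξ + s * ξ ^ 3 : ℝ) : ℂ) * I) * (((b + 3 * s * ξ ^ 2 : ℝ) : ℂ) * I)) ξ :=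
    fun ξ => ((hd1 ξ).ofReal_comp.mul_const I).cexp
  have hce : Continuous fun ξ : ℝ => Complex.exp (((b * ξ + s * ξ ^ 3 : ℝ) : ℂ) * I) := by fun_prop
  have hnorm : ∀ ξ : ℝ, ‖Complex.exp (((b * ξ + s * ξ ^ 3 : ℝ) : ℂ) * I)‖ = 1 := fun ξ =>
    Complex.norm_exp_ofReal_mul_I _
  set P : ℝ → ℂ := fun ξ => Complex.exp (((b * ξ + s * ξ ^ 3 : ℝ) : ℂ) * I) /
    (((b + 3 * s * ξ ^ 2 : ℝ) : ℂ) * I) with hP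
  set R : ℝ → ℂ := fun ξ => Complex.exp (((b * ξ + s * ξ ^ 3 : ℝ) : ℂ) * I) *
    ((6 * s * ξ : ℝ) : ℂ) / (((b + 3 * s * ξ ^ 2 : ℝ) : ℂ) ^ 2 * I) with hR
  have hdP : ∀ ξ ∈ Set.uIcc a c, HasDerivAt P
      (Complex.exp (((b * ξ + s * ξ ^ 3 : ℝ) : ℂ) * I) - R ξ) ξ := by
    intro ξ hξ
    rw [hIcc] at hξ
    have h1 := (hde ξ).div ((hd2 ξ).ofReal_comp.mul_const I)
      (mul_ne_zero (hneC ξ hξ) Complex.I_ne_zero)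
    refine h1.congr_deriv ?_
    have := hneC ξ hξ
    simp only [hR]
    generalize ((b + 3 * s * ξ ^ 2 : ℝ) : ℂ) = w at this ⊢
    generalize Complex.exp (((b * ξ + s * ξ ^ 3 : ℝ) : ℂ) * I) = e
    have hI := Complex.I_ne_zero
    field_simp
  have hRc : ContinuousOn R (Set.uIcc a c) := by
    rw [hIcc]
    apply ContinuousOn.div (by fun_prop) (by fun_prop)
    intro ξ hξ
    exact mul_ne_zero (pow_ne_zero 2 (hneC ξ hξ)) Complex.I_ne_zero
  have hRi : IntervalIntegrable R volume a c := hRc.intervalIntegrable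
  have hei : IntervalIntegrable (fun ξ : ℝ => Complex.exp (((b * ξ + s * ξ ^ 3 : ℝ) : ℂ) * I))
    volume a c := hce.intervalIntegrable _ _
  have hFTC := intervalIntegral.integral_eq_sub_of_hasDerivAt hdP (hei.sub hRi)
  rw [intervalIntegral.integral_sub hei hRi] at hFTC
  have heq : ∫ ξ in a..c, Complex.exp (((b * ξ + s * ξ ^ 3 : ℝ) : ℂ) * I) =
      P c - P a + ∫ ξ in a..c, R ξ := by rw [← hFTC]; ring
  have hPb : ∀ ξ ∈ Set.Icc a c, ‖P ξ‖ ≤ 1 / δ := by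
    intro ξ hξ
    simp only [hP]
    rw [norm_div, hnorm, norm_mul, Complex.norm_I, mul_one, Complex.norm_real, Real.norm_eq_abs]
    exact one_div_le_one_div_of_le hδ (hp ξ hξ)
  have hdQ : ∀ ξ ∈ Set.uIcc a c, HasDerivAt (fun ξ : ℝ => -(b + 3 * s * ξ ^ 2)⁻¹)
      (6 * s * ξ / (b + 3 * s * ξ ^ 2) ^ 2) ξ := by
    intro ξ hξ
    rw [hIcc] at hξ
    refine ((hd2 ξ).inv (hne ξ hξ)).neg.congr_deriv ?_
    ring
  have hRbound : ‖∫ ξ in a..c, R ξ‖ ≤ 2 / δ := by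
    have hQi : IntervalIntegrable (fun ξ => 6 * s * ξ / (b + 3 * s * ξ ^ 2) ^ 2) volume a c := by
      apply ContinuousOn.intervalIntegrable
      rw [hIcc]
      apply ContinuousOn.div (by fun_prop) (by fun_prop)
      intro ξ hξ
      exact pow_ne_zero 2 (hne ξ hξ)
    have h1 : ‖∫ ξ in a..c, R ξ‖ ≤ ∫ ξ in a..c, 6 * s * ξ / (b + 3 * s * ξ ^ 2) ^ 2 := by
      refine intervalIntegral.norm_integral_le_of_norm_le hac ?_ hQi
      refine Filter.Eventually.of_forall fun ξ hξ => le_of_eq ?_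
      have hξ0 : 0 ≤ ξ := ha.trans hξ.1.le
      simp only [hR]
      rw [norm_div, norm_mul, hnorm, norm_mul, norm_pow, Complex.norm_I, Complex.norm_real,
        Complex.norm_real, Real.norm_eq_abs, Real.norm_eq_abs, sq_abs, one_mul, mul_one,
        abs_of_nonneg (by positivity)]
    rw [intervalIntegral.integral_eq_sub_of_hasDerivAt hdQ hQi] at h1
    have hb : ∀ ξ ∈ Set.Icc a c, |(b + 3 * s * ξ ^ 2)⁻¹| ≤ 1 / δ := fun ξ hξ => by
      rw [abs_inv, ← one_div]
      exact one_div_le_one_div_of_le hδ (hp ξ hξ)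
    have hb1 := abs_le.1 (hb a ⟨le_rfl, hac⟩)
    have hb2 := abs_le.1 (hb c ⟨hac, le_rfl⟩)
    have : 2 / δ = 1 / δ + 1 / δ := by ring
    linarith
  rw [heq]
  calc _ ≤ ‖P c‖ + ‖P a‖ + ‖∫ ξ in a..c, R ξ‖ :=
        (norm_add_le _ _).trans (by gcongr; exact norm_sub_le _ _)
    _ ≤ 1 / δ + 1 / δ + 2 / δ := by
        gcongr
        · exact hPb c ⟨hac, le_rfl⟩
        · exact hPb a ⟨le_rfl, hac⟩
    _ = 4 / δ := by ring

theorem norm_integral_cubic_phase_half_le {b s R : ℝ} (hs : 0 < s) (hR : 0 ≤ R) :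
    ‖∫ ξ in (0:ℝ)..R, Complex.exp (((b * ξ + s * ξ ^ 3 : ℝ) : ℂ) * I)‖ ≤
      9 * s ^ (-(1/3) : ℝ) := by
  set δ : ℝ := s ^ (1/3 : ℝ) with hδd
  have hδ : 0 < δ := by positivity
  have hδ3 : δ ^ 3 = s := by
    rw [hδd, ← Real.rpow_natCast, ← Real.rpow_mul hs.le]; norm_num
  have hδinv : s ^ (-(1/3) : ℝ) = 1 / δ := by
    rw [Real.rpow_neg hs.le, one_div δ]
  set x₁ : ℝ := √((-b - δ) / (3 * s)) with hx₁
  set x₂ : ℝ := √((-b + δ) / (3 * s)) with hx₂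
  have hx₁0 : 0 ≤ x₁ := Real.sqrt_nonneg _
  have hx₂0 : 0 ≤ x₂ := Real.sqrt_nonneg _
  have h12 : x₁ ≤ x₂ := Real.sqrt_le_sqrt (by gcongr; linarith)
  have hdiff : x₂ - x₁ ≤ 1 / δ := by
    apply abs_le_of_sq_le_sq' _ (by positivity) |>.2
    have hsq : x₂ ^ 2 - x₁ ^ 2 ≤ 2 * δ / (3 * s) := by
      by_cases h : 0 ≤ (-b + δ) / (3 * s)
      · rw [hx₂, Real.sq_sqrt h]
        have : (-b - δ) / (3 * s) ≤ x₁ ^ 2 := by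
          by_cases h' : 0 ≤ (-b - δ) / (3 * s)
          · rw [hx₁, Real.sq_sqrt h']
          · exact (not_le.1 h').le.trans (sq_nonneg _)
        have e : 2 * δ / (3 * s) = (-b + δ) / (3 * s) - (-b - δ) / (3 * s) := by ring
        linarith
      · have : x₂ = 0 := Real.sqrt_eq_zero_of_nonpos (not_le.1 h).le
        rw [this]
        have : 0 ≤ 2 * δ / (3 * s) := by positivity
        nlinarith [sq_nonneg x₁]
    have h3 : 2 * δ / (3 * s) ≤ (1 / δ) ^ 2 := by
      rw [← hδ3, div_pow, one_pow, div_le_div_iff₀ (by positivity) (by positivity)]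
      nlinarith [pow_pos hδ 3]
    nlinarith
  set a₁ := min x₁ R with ha₁
  set a₂ := min x₂ R with ha₂
  have ha₁0 : 0 ≤ a₁ := le_min hx₁0 hR
  have ha12 : a₁ ≤ a₂ := min_le_min_right R h12
  have ha₂R : a₂ ≤ R := min_le_right _ _
  have hci : ∀ u v : ℝ, IntervalIntegrable
      (fun ξ : ℝ => Complex.exp (((b * ξ + s * ξ ^ 3 : ℝ) : ℂ) * I)) volume u v :=
    fun u v => Continuous.intervalIntegrable (by fun_prop) _ _
  rw [← intervalIntegral.integral_add_adjacent_intervals (hci 0 a₁) (hci a₁ R),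
    ← intervalIntegral.integral_add_adjacent_intervals (hci a₁ a₂) (hci a₂ R), hδinv]
  have e1 : ‖∫ ξ in (0:ℝ)..a₁, Complex.exp (((b * ξ + s * ξ ^ 3 : ℝ) : ℂ) * I)‖ ≤ 4 / δ := by
    rcases eq_or_lt_of_le hx₁0 with h0 | hpos
    · have : a₁ = 0 := by rw [ha₁, ← h0, min_eq_left hR]
      rw [this, intervalIntegral.integral_same, norm_zero]
      positivity
    · refine norm_integral_cubic_phase_le hδ le_rfl ha₁0 hs fun ξ hξ => ?_
      have h1 : ξ ≤ x₁ := hξ.2.trans (min_le_left _ _)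
      have h2 : ξ ^ 2 ≤ (-b - δ) / (3 * s) := by
        rw [← Real.sq_sqrt (Real.sqrt_pos.1 hpos).le]
        exact pow_le_pow_left₀ hξ.1 h1 2
      rw [le_div_iff₀ (by positivity)] at h2
      rw [le_abs]; right; nlinarith
  have e3 : ‖∫ ξ in a₂..R, Complex.exp (((b * ξ + s * ξ ^ 3 : ℝ) : ℂ) * I)‖ ≤ 4 / δ := by
    rcases le_total R x₂ with h | h
    · have : a₂ = R := min_eq_right h
      rw [this, intervalIntegral.integral_same, norm_zero]
      positivity
    · refine norm_integral_cubic_phase_le hδ (ha₁0.trans ha12) ha₂R hs fun ξ hξ => ?_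
      have h1 : x₂ ≤ ξ := by rw [← min_eq_left h]; exact hξ.1
      have h2 : (-b + δ) / (3 * s) ≤ ξ ^ 2 := by
        by_cases h' : 0 ≤ (-b + δ) / (3 * s)
        · rw [← Real.sq_sqrt h']
          exact pow_le_pow_left₀ hx₂0 h1 2
        · exact (not_le.1 h').le.trans (sq_nonneg _)
      rw [div_le_iff₀ (by positivity)] at h2
      rw [le_abs]; left; nlinarith
  have e2 : ‖∫ ξ in a₁..a₂, Complex.exp (((b * ξ + s * ξ ^ 3 : ℝ) : ℂ) * I)‖ ≤ 1 / δ := by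
    refine (intervalIntegral.norm_integral_le_of_norm_le_const (C := 1) fun ξ _ =>
      (Complex.norm_exp_ofReal_mul_I _).le).trans ?_
    rw [one_mul, abs_of_nonneg (by linarith)]
    refine le_trans ?_ hdiff
    rcases le_total R x₁ with h | h
    · rw [ha₁, ha₂, min_eq_right h, min_eq_right (h.trans h12)]; linarith
    · rw [ha₁, min_eq_left h]
      linarith [min_le_left x₂ R]
  calc _ ≤ 4 / δ + (1 / δ + 4 / δ) :=
        (norm_add_le _ _).trans (add_le_add e1 ((norm_add_le _ _).trans (add_le_add e2 e3)))
    _ = 9 * (1 / δ) := by ring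

theorem norm_integral_cubic_phase_sym_le {b s R : ℝ} (hs : s ≠ 0) (hR : 0 ≤ R) :
    ‖∫ ξ in (-R)..R, Complex.exp (((b * ξ + s * ξ ^ 3 : ℝ) : ℂ) * I)‖ ≤
      18 * |s| ^ (-(1/3) : ℝ) := by
  have half : ∀ b : ℝ, ‖∫ ξ in (0:ℝ)..R, Complex.exp (((b * ξ + s * ξ ^ 3 : ℝ) : ℂ) * I)‖ ≤
      9 * |s| ^ (-(1/3) : ℝ) := by
    intro b
    rcases lt_or_gt_of_ne hs with h | h
    · have := norm_integral_cubic_phase_half_le (b := -b) (neg_pos.2 h) hR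
      rw [abs_of_neg h]
      refine le_trans (le_of_eq ?_) this
      rw [← RCLike.norm_conj, ← intervalIntegral.intervalIntegral_conj]
      congr 2
      ext ξ
      rw [← Complex.exp_conj]
      simp
      ring_nf
    · rw [abs_of_pos h]
      exact norm_integral_cubic_phase_half_le h hR
  have half' : ‖∫ ξ in (-R)..0, Complex.exp (((b * ξ + s * ξ ^ 3 : ℝ) : ℂ) * I)‖ ≤
      9 * |s| ^ (-(1/3) : ℝ) := by
    refine le_trans (le_of_eq ?_) (half b)
    nth_rewrite 1 [← neg_zero]
    rw [← intervalIntegral.integral_comp_neg, ← RCLike.norm_conj,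
      ← intervalIntegral.intervalIntegral_conj]
    congr 2
    ext ξ
    rw [← Complex.exp_conj]
    simp
    ring_nf
  rw [← intervalIntegral.integral_add_adjacent_intervals (b := 0)
    (Continuous.intervalIntegrable (by fun_prop) _ _)
    (Continuous.intervalIntegrable (by fun_prop) _ _)]
  calc _ ≤ _ := norm_add_le _ _
    _ ≤ 9 * |s| ^ (-(1/3) : ℝ) + 9 * |s| ^ (-(1/3) : ℝ) := add_le_add half' (half b)
    _ = _ := by ring

/-- The inverse Fourier transform of an integrable square integrable function agrees with its
`L²` inverse Fourier transform. -/
theorem fourierInv_toLp_ae_eq {g : E2 → ℂ} (h1 : Integrable g) (h2 : MemLp g 2 volume) :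
    ((𝓕⁻ (h2.toLp g) : Lp ℂ 2 (volume : Measure E2)) : E2 → ℂ) =ᵐ[volume] 𝓕⁻ g := by
  have hcont : Continuous (𝓕⁻ g) := by
    rw [Real.fourierInv_eq_fourier_comp_neg]
    exact VectorFourier.fourierIntegral_continuous Real.continuous_fourierChar
      continuous_inner h1.comp_neg
  apply ae_eq_of_integral_contDiff_smul_eq
  · exact (Lp.memLp _).locallyIntegrable (by norm_num)
  · exact hcont.locallyIntegrable
  intro φ hφ hφc
  have hφC : ContDiff ℝ (⊤ : ℕ∞) (fun x => (φ x : ℂ)) := Complex.ofRealCLM.contDiff.comp hφ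
  have hφCc : HasCompactSupport (fun x => (φ x : ℂ)) := hφc.comp_left Complex.ofReal_zero
  set Φ := hφCc.toSchwartzMap hφC with hΦ
  have e1 := DFunLike.congr_fun (Lp.fourierInv_toTemperedDistribution_eq (h2.toLp g)) Φ
  rw [TemperedDistribution.fourierInv_apply, Lp.toTemperedDistribution_apply,
    Lp.toTemperedDistribution_apply] at e1
  have e2 : ∫ x, φ x • ((𝓕⁻ (h2.toLp g) : Lp ℂ 2 (volume : Measure E2)) : E2 → ℂ) x =
      ∫ x, (𝓕⁻ Φ) x • (h2.toLp g : E2 → ℂ) x := by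
    rw [e1]
    rfl
  have e3 : ∫ x, (𝓕⁻ Φ) x • (h2.toLp g : E2 → ℂ) x = ∫ x, (𝓕⁻ Φ) x • g x :=
    integral_congr_ae (h2.coeFn_toLp.mono fun x hx => by simp only [hx])
  have e4 : ∫ x, (𝓕⁻ Φ) x • g x = ∫ x, 𝓕 (Φ : E2 → ℂ) x • g (-x) := by
    rw [← integral_neg_eq_self]
    refine integral_congr_ae (Filter.Eventually.of_forall fun x => ?_)
    simp only
    rw [SchwartzMap.fourierInv_coe, Real.fourierInv_eq_fourier_neg, neg_neg]
  have e5 := VectorFourier.integral_fourierIntegral_smul_eq_flip (𝕜 := ℝ) (e := Real.fourierChar)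
    (L := innerₗ E2) (μ := volume) (ν := volume) (f := (Φ : E2 → ℂ)) (g := fun x => g (-x))
    Real.continuous_fourierChar continuous_inner Φ.integrable h1.comp_neg
  rw [e2, e3, e4]
  refine e5.trans ?_
  rw [Real.fourierInv_eq_fourier_comp_neg, flip_innerₗ]
  rfl

theorem memLp_fourierInv {g : E2 → ℂ} (h1 : Integrable g) (h2 : MemLp g 2 volume) :
    MemLp (𝓕⁻ g) 2 volume :=
  (memLp_congr_ae (fourierInv_toLp_ae_eq h1 h2)).1 (Lp.memLp _)

open scoped ComplexConjugate in
/-- Parseval's identity for integrable square integrable functions. -/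
theorem integral_fourierInv_mul_conj {g h : E2 → ℂ} (hg1 : Integrable g)
    (hg2 : MemLp g 2 volume) (hh1 : Integrable h) (hh2 : MemLp h 2 volume) :
    ∫ y, 𝓕⁻ g y * conj (𝓕⁻ h y) = ∫ ξ, g ξ * conj (h ξ) := by
  have e := Lp.inner_fourier_eq (𝓕⁻ (hh2.toLp h)) (𝓕⁻ (hg2.toLp g))
  rw [FourierTransform.fourier_fourierInv_eq, FourierTransform.fourier_fourierInv_eq,
    MeasureTheory.L2.inner_def, MeasureTheory.L2.inner_def] at e
  calc _ = ∫ a, inner ℂ ((𝓕⁻ (hh2.toLp h) : Lp ℂ 2 (volume : Measure E2)) a)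
        ((𝓕⁻ (hg2.toLp g) : Lp ℂ 2 (volume : Measure E2)) a) := by
        refine integral_congr_ae ?_
        filter_upwards [fourierInv_toLp_ae_eq hg1 hg2, fourierInv_toLp_ae_eq hh1 hh2] with a h1 h2
        rw [h1, h2, RCLike.inner_apply]
    _ = _ := e.symm
    _ = _ := by
        refine integral_congr_ae ?_
        filter_upwards [hg2.coeFn_toLp, hh2.coeFn_toLp] with a h1 h2
        rw [h1, h2, RCLike.inner_apply]

open scoped ComplexConjugate in
/-- The properties of a space-time convolution kernel from which Strichartz estimates follow. -/
structure IsDispersive (K : ℝ × E2 → ℂ) : Prop where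
  continuous : Continuous K
  bounded : ∃ B : ℝ, ∀ z, ‖K z‖ ≤ B
  decay : ∀ z : ℝ × E2, ‖K z‖ₑ ≤ 324 * ‖z.1‖ₑ ^ (-(2/3) : ℝ)
  square : ∃ D : ℝ≥0∞, D ≠ ∞ ∧ ∀ a : ℝ, ∫⁻ y : E2, ‖K (a, y)‖ₑ ^ 2 ≤ D
  conj_symm : ∀ z, K (-z) = conj (K z)
  composition : ∀ (a b : ℝ) (x x' : E2),
    ∫ y : E2, K (a, y - x) * conj (K (b, y - x')) = K (a - b, x' - x)

open scoped ComplexConjugate in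
theorem IsDispersive.conj {K : ℝ × E2 → ℂ} (hK : IsDispersive K) :
    IsDispersive fun z => conj (K z) where
  continuous := Complex.continuous_conj.comp hK.continuous
  bounded := by simpa using hK.bounded
  decay z := by
    simpa only [enorm_eq_nnnorm, RCLike.nnnorm_conj] using hK.decay z
  square := by simpa only [enorm_eq_nnnorm, RCLike.nnnorm_conj] using hK.square
  conj_symm z := by rw [hK.conj_symm]
  composition a b x x' := by
    rw [← hK.composition, ← integral_conj]
    simp only [map_mul]

/-- The square frequency cutoff at scale `R`. -/
def freqBox (R : ℝ) : Set E2 := {ξ | |ξ 0| ≤ R ∧ |ξ 1| ≤ R}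

theorem isClosed_freqBox (R : ℝ) : IsClosed (freqBox R) := by
  have h : ∀ i : Fin 2, Continuous fun ξ : E2 => |ξ i| := fun i => by fun_prop
  exact (isClosed_le (h 0) continuous_const).inter (isClosed_le (h 1) continuous_const)

theorem isBounded_freqBox (R : ℝ) : Bornology.IsBounded (freqBox R) := by
  refine (Metric.isBounded_closedBall (x := (0 : E2)) (r := √(2 * R ^ 2))).subset fun ξ hξ => ?_
  rw [mem_closedBall_zero_iff, EuclideanSpace.norm_eq]
  apply Real.sqrt_le_sqrt
  have h0 := abs_le.1 hξ.1
  have h1 := abs_le.1 hξ.2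
  simp only [Fin.sum_univ_two, Real.norm_eq_abs, sq_abs]
  nlinarith

/-- The symbol of `V(s)` restricted to a frequency box. -/
def cutSymbol (R s : ℝ) : E2 → ℂ :=
  (freqBox R).indicator fun ξ => Complex.exp (Complex.I * s * ((ξ 0 : ℂ) ^ 3 + (ξ 1 : ℂ) ^ 3))

/-- The convolution kernel of `V(s)` restricted to a frequency box. -/
def cutKernel (R : ℝ) (z : ℝ × E2) : ℂ := 𝓕⁻ (cutSymbol R z.1) z.2

theorem norm_symbol (s : ℝ) (ξ : E2) :
    ‖Complex.exp (Complex.I * s * ((ξ 0 : ℂ) ^ 3 + (ξ 1 : ℂ) ^ 3))‖ = 1 := by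
  rw [show Complex.I * s * ((ξ 0 : ℂ) ^ 3 + (ξ 1 : ℂ) ^ 3) =
    ((s * (ξ 0 ^ 3 + ξ 1 ^ 3) : ℝ) : ℂ) * I by push_cast; ring]
  exact Complex.norm_exp_ofReal_mul_I _

theorem norm_cutSymbol_le (R s : ℝ) (ξ : E2) :
    ‖cutSymbol R s ξ‖ ≤ (freqBox R).indicator (fun _ => (1 : ℝ)) ξ := by
  unfold cutSymbol
  by_cases h : ξ ∈ freqBox R
  · rw [Set.indicator_of_mem h, Set.indicator_of_mem h, norm_symbol]
  · rw [Set.indicator_of_notMem h, Set.indicator_of_notMem h, norm_zero]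

theorem measurable_cutSymbol (R s : ℝ) : Measurable (cutSymbol R s) :=
  Measurable.indicator (Continuous.measurable (by fun_prop)) (isClosed_freqBox R).measurableSet

theorem integrable_indicator_freqBox (R : ℝ) :
    Integrable ((freqBox R).indicator (fun _ => (1 : ℝ))) :=
  (integrable_indicator_iff (isClosed_freqBox R).measurableSet).2
    (integrableOn_const (isBounded_freqBox R).measure_lt_top.ne)

theorem integrable_cutSymbol (R s : ℝ) : Integrable (cutSymbol R s) :=
  (integrable_indicator_freqBox R).mono' (measurable_cutSymbol R s).aestronglyMeasurable
    (Filter.Eventually.of_forall (norm_cutSymbol_le R s))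

theorem norm_wave_mul (x ξ : E2) (c : ℂ) :
    ‖Complex.exp ((2 * π * inner ℝ ξ x : ℝ) * I) * c‖ = ‖c‖ := by
  rw [norm_mul, Complex.norm_exp_ofReal_mul_I, one_mul]

theorem cutKernel_eq (R : ℝ) (z : ℝ × E2) :
    cutKernel R z = ∫ ξ, Complex.exp ((2 * π * inner ℝ ξ z.2 : ℝ) * I) * cutSymbol R z.1 ξ := by
  rw [cutKernel, Real.fourierInv_eq']
  simp [smul_eq_mul]

/-- Modulating a function translates its inverse Fourier transform. -/
theorem fourierInv_modulate (g : E2 → ℂ) (x y : E2) :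
    𝓕⁻ (fun ξ => Complex.exp ((2 * π * inner ℝ ξ (-x) : ℝ) * I) * g ξ) y = 𝓕⁻ g (y - x) := by
  rw [Real.fourierInv_eq', Real.fourierInv_eq']
  congr 1 with ξ
  simp only [smul_eq_mul]
  rw [← mul_assoc, ← Complex.exp_add, inner_sub_right, inner_neg_right]
  congr 2
  push_cast
  ring

theorem continuous_cutKernel (R : ℝ) : Continuous (cutKernel R) := by
  simp_rw [funext (cutKernel_eq R)]
  refine continuous_of_dominated (bound := (freqBox R).indicator (fun _ => (1 : ℝ))) ?_ ?_
    (integrable_indicator_freqBox R) ?_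
  · intro z
    exact ((Continuous.measurable (by fun_prop)).mul
      (measurable_cutSymbol R z.1)).aestronglyMeasurable
  · intro z
    refine Filter.Eventually.of_forall fun ξ => ?_
    rw [norm_wave_mul]
    exact norm_cutSymbol_le _ _ _
  · refine Filter.Eventually.of_forall fun ξ => ?_
    unfold cutSymbol
    by_cases h : ξ ∈ freqBox R
    · simp only [Set.indicator_of_mem h]
      fun_prop
    · simp only [Set.indicator_of_notMem h]
      fun_prop

theorem memLp_cutSymbol (R s : ℝ) : MemLp (cutSymbol R s) 2 volume := by
  have h : MemLp ((freqBox R).indicator (fun _ => (1 : ℝ))) 2 (volume : Measure E2) :=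
    memLp_indicator_const _ (isClosed_freqBox R).measurableSet _
      (Or.inr (isBounded_freqBox R).measure_lt_top.ne)
  exact h.mono' (measurable_cutSymbol R s).aestronglyMeasurable
    (Filter.Eventually.of_forall (norm_cutSymbol_le R s))

theorem cutKernel_decay {R : ℝ} (hR : 0 ≤ R) (z : ℝ × E2) :
    ‖cutKernel R z‖ₑ ≤ 324 * ‖z.1‖ₑ ^ (-(2/3) : ℝ) := by
  rcases eq_or_ne z.1 0 with h0 | h0
  · rw [h0, enorm_zero, ENNReal.zero_rpow_of_neg (by norm_num), ENNReal.mul_top (by norm_num)]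
    exact le_top
  have hprod : cutKernel R z = ∏ i : Fin 2, ∫ ξ in (-R)..R,
      Complex.exp (((2 * π * z.2 i * ξ + z.1 * ξ ^ 3 : ℝ) : ℂ) * I) := by
    rw [cutKernel_eq, ← (PiLp.volume_preserving_toLp (Fin 2)).integral_comp
      (MeasurableEquiv.toLp 2 _).measurableEmbedding]
    have : ∀ i : Fin 2, ∫ ξ in (-R)..R,
        Complex.exp (((2 * π * z.2 i * ξ + z.1 * ξ ^ 3 : ℝ) : ℂ) * I) =
        ∫ ξ, (Set.Icc (-R) R).indicator (fun ξ : ℝ =>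
          Complex.exp (((2 * π * z.2 i * ξ + z.1 * ξ ^ 3 : ℝ) : ℂ) * I)) ξ := fun i => by
      rw [intervalIntegral.integral_of_le (by linarith), ← integral_Icc_eq_integral_Ioc,
        integral_indicator measurableSet_Icc]
    simp_rw [this]
    rw [← integral_fin_nat_prod_volume_eq_prod]
    congr 1 with v
    rw [Fin.prod_univ_two]
    unfold cutSymbol
    by_cases h : WithLp.toLp 2 v ∈ freqBox R
    · have hv0 : v 0 ∈ Set.Icc (-R) R := abs_le.1 h.1
      have hv1 : v 1 ∈ Set.Icc (-R) R := abs_le.1 h.2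
      rw [Set.indicator_of_mem h, Set.indicator_of_mem hv0, Set.indicator_of_mem hv1,
        ← Complex.exp_add, ← Complex.exp_add]
      congr 1
      simp only [PiLp.inner_apply, Fin.sum_univ_two, RCLike.inner_apply, conj_trivial]
      push_cast
      ring
    · rw [Set.indicator_of_notMem h, mul_zero]
      by_cases hv0 : v 0 ∈ Set.Icc (-R) R
      · have hv1 : v 1 ∉ Set.Icc (-R) R := fun hv1 => h ⟨abs_le.2 hv0, abs_le.2 hv1⟩
        rw [Set.indicator_of_notMem hv1, mul_zero]
      · rw [Set.indicator_of_notMem hv0, zero_mul]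
  have hb : ‖cutKernel R z‖ ≤ 324 * |z.1| ^ (-(2/3) : ℝ) := by
    rw [hprod, Fin.prod_univ_two, norm_mul]
    calc _ ≤ (18 * |z.1| ^ (-(1/3) : ℝ)) * (18 * |z.1| ^ (-(1/3) : ℝ)) :=
          mul_le_mul (norm_integral_cubic_phase_sym_le h0 hR)
            (norm_integral_cubic_phase_sym_le h0 hR) (norm_nonneg _) (by positivity)
      _ = 324 * (|z.1| ^ (-(1/3) : ℝ) * |z.1| ^ (-(1/3) : ℝ)) := by ring
      _ = _ := by
          rw [← Real.rpow_add (abs_pos.2 h0)]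
          norm_num
  have hpos : 0 < |z.1| := abs_pos.2 h0
  calc ‖cutKernel R z‖ₑ = ENNReal.ofReal ‖cutKernel R z‖ := (ofReal_norm _).symm
    _ ≤ ENNReal.ofReal (324 * |z.1| ^ (-(2/3) : ℝ)) := ENNReal.ofReal_le_ofReal hb
    _ = _ := by
        rw [ENNReal.ofReal_mul (by norm_num), ← ENNReal.ofReal_rpow_of_pos hpos,
          ← Real.norm_eq_abs, ofReal_norm]
        norm_num

open scoped ComplexConjugate in
theorem cutSymbol_mul_conj (R a b : ℝ) (ξ : E2) :
    cutSymbol R a ξ * conj (cutSymbol R b ξ) = cutSymbol R (a - b) ξ := by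
  unfold cutSymbol
  by_cases h : ξ ∈ freqBox R
  · simp only [Set.indicator_of_mem h]
    rw [← Complex.exp_conj, ← Complex.exp_add]
    congr 1
    simp
    ring
  · simp only [Set.indicator_of_notMem h, zero_mul]

open scoped ComplexConjugate in
theorem conj_cutSymbol (R a : ℝ) (ξ : E2) :
    conj (cutSymbol R a ξ) = cutSymbol R (-a) ξ := by
  unfold cutSymbol
  by_cases h : ξ ∈ freqBox R
  · simp only [Set.indicator_of_mem h]
    rw [← Complex.exp_conj]
    congr 1
    simp
  · simp only [Set.indicator_of_notMem h, map_zero]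

open scoped ComplexConjugate in
theorem conj_wave (x ξ : E2) :
    conj (Complex.exp ((2 * π * inner ℝ ξ x : ℝ) * I)) =
      Complex.exp ((2 * π * inner ℝ ξ (-x) : ℝ) * I) := by
  rw [← Complex.exp_conj, map_mul, Complex.conj_ofReal, Complex.conj_I, inner_neg_right]
  congr 1
  push_cast
  ring

theorem integrable_wave_mul {g : E2 → ℂ} (hg : Integrable g) (x : E2) :
    Integrable fun ξ => Complex.exp ((2 * π * inner ℝ ξ x : ℝ) * I) * g ξ :=
  hg.mono ((Continuous.aestronglyMeasurable (by fun_prop)).mul hg.aestronglyMeasurable)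
    (Filter.Eventually.of_forall fun ξ => (norm_wave_mul x ξ _).le)

theorem memLp_wave_mul {g : E2 → ℂ} (hg : MemLp g 2 volume) (x : E2) :
    MemLp (fun ξ => Complex.exp ((2 * π * inner ℝ ξ x : ℝ) * I) * g ξ) 2 volume :=
  hg.mono ((Continuous.aestronglyMeasurable (by fun_prop)).mul hg.aestronglyMeasurable)
    (Filter.Eventually.of_forall fun ξ => (norm_wave_mul x ξ _).le)

open scoped ComplexConjugate in
theorem cutKernel_composition (R a b : ℝ) (x x' : E2) :
    ∫ y : E2, cutKernel R (a, y - x) * conj (cutKernel R (b, y - x')) =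
      cutKernel R (a - b, x' - x) := by
  simp only [cutKernel]
  simp_rw [← fourierInv_modulate]
  rw [integral_fourierInv_mul_conj (integrable_wave_mul (integrable_cutSymbol R a) _)
    (memLp_wave_mul (memLp_cutSymbol R a) _) (integrable_wave_mul (integrable_cutSymbol R b) _)
    (memLp_wave_mul (memLp_cutSymbol R b) _), Real.fourierInv_eq']
  congr 1 with ξ
  rw [map_mul, conj_wave, neg_neg, smul_eq_mul, ← cutSymbol_mul_conj, inner_neg_right]
  rw [show ∀ p q r s : ℂ, p * q * (r * s) = r * (p * (q * s)) from fun p q r s => by ring]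

open scoped ComplexConjugate in
theorem cutKernel_neg (R : ℝ) (z : ℝ × E2) : cutKernel R (-z) = conj (cutKernel R z) := by
  rw [cutKernel_eq, cutKernel_eq, ← integral_conj]
  congr 1 with ξ
  rw [map_mul, conj_wave, conj_cutSymbol]
  rfl

theorem norm_cutKernel_le (R : ℝ) (z : ℝ × E2) :
    ‖cutKernel R z‖ ≤ ∫ ξ, (freqBox R).indicator (fun _ => (1 : ℝ)) ξ := by
  rw [cutKernel_eq]
  refine norm_integral_le_of_norm_le (integrable_indicator_freqBox R)
    (Filter.Eventually.of_forall fun ξ => ?_)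
  rw [norm_wave_mul]
  exact norm_cutSymbol_le _ _ _

open scoped ComplexConjugate in
theorem lintegral_cutKernel_sq (R a : ℝ) :
    ∫⁻ y : E2, ‖cutKernel R (a, y)‖ₑ ^ 2 = ENNReal.ofReal (cutKernel R 0).re := by
  have hmem : MemLp (fun y => cutKernel R (a, y)) 2 volume :=
    memLp_fourierInv (integrable_cutSymbol R a) (memLp_cutSymbol R a)
  have hc := cutKernel_composition R a a 0 0
  simp only [sub_zero, sub_self] at hc
  have hi : Integrable fun y => ‖cutKernel R (a, y)‖ ^ 2 := hmem.integrable_norm_pow (by norm_num)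
  have hc' : ∫ y, ‖cutKernel R (a, y)‖ ^ 2 = (cutKernel R 0).re := by
    have h1 : ∫ y : E2, cutKernel R (a, y) * conj (cutKernel R (a, y)) =
        ((∫ y, ‖cutKernel R (a, y)‖ ^ 2 : ℝ) : ℂ) := by
      rw [← integral_complex_ofReal]
      congr 1 with y
      rw [Complex.mul_conj, Complex.normSq_eq_norm_sq]
    rw [h1] at hc
    have := congrArg Complex.re hc
    rwa [Complex.ofReal_re] at this
  rw [← hc', ofReal_integral_eq_lintegral_ofReal hi (Filter.Eventually.of_forall fun _ => by
    positivity)]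
  congr 1 with y
  rw [ENNReal.ofReal_pow (norm_nonneg _), ofReal_norm]

theorem isDispersive_cutKernel {R : ℝ} (hR : 0 ≤ R) : IsDispersive (cutKernel R) where
  continuous := continuous_cutKernel R
  bounded := ⟨_, norm_cutKernel_le R⟩
  decay := cutKernel_decay hR
  square := ⟨_, ENNReal.ofReal_ne_top, fun a => (lintegral_cutKernel_sq R a).le⟩
  conj_symm := cutKernel_neg R
  composition := cutKernel_composition R

/-- Convolution with the truncated kernel, on the Fourier side. -/
theorem integral_mul_cutKernel {f : E2 → ℂ} (hf : Integrable f) (R s : ℝ) (x : E2) :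
    ∫ y, f y * cutKernel R (s, x - y) =
      ∫ ξ, Complex.exp ((2 * π * inner ℝ ξ x : ℝ) * I) * cutSymbol R s ξ * 𝓕 f ξ := by
  have e := VectorFourier.integral_fourierIntegral_smul_eq_flip (𝕜 := ℝ) (e := Real.fourierChar)
    (L := innerₗ E2) (μ := volume) (ν := volume) (f := f)
    (g := fun ξ => Complex.exp ((2 * π * inner ℝ ξ x : ℝ) * I) * cutSymbol R s ξ)
    Real.continuous_fourierChar continuous_inner hf
    (integrable_wave_mul (integrable_cutSymbol R s) x)
  rw [flip_innerₗ] at e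
  have e1 : ∀ y, VectorFourier.fourierIntegral Real.fourierChar volume (innerₗ E2)
      (fun ξ => Complex.exp ((2 * π * inner ℝ ξ x : ℝ) * I) * cutSymbol R s ξ) y =
      cutKernel R (s, x - y) := by
    intro y
    have : VectorFourier.fourierIntegral Real.fourierChar volume (innerₗ E2)
      (fun ξ => Complex.exp ((2 * π * inner ℝ ξ x : ℝ) * I) * cutSymbol R s ξ) y =
      𝓕 (fun ξ => Complex.exp ((2 * π * inner ℝ ξ x : ℝ) * I) * cutSymbol R s ξ) y := rfl
    rw [this, ← neg_neg y, ← Real.fourierInv_eq_fourier_neg, ← neg_neg x, fourierInv_modulate]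
    rw [cutKernel, neg_neg, sub_neg_eq_add, sub_eq_neg_add]
    simp only [neg_neg]
  simp_rw [e1, smul_eq_mul] at e
  rw [← e]
  congr 1 with ξ
  rw [mul_comm]
  rfl

theorem norm_integral_mul_cutKernel_le {f : E2 → ℂ} (hf : Integrable f) (hf' : Integrable (𝓕 f))
    (R s : ℝ) (x : E2) : ‖∫ y, f y * cutKernel R (s, x - y)‖ ≤ ∫ ξ, ‖𝓕 f ξ‖ := by
  rw [integral_mul_cutKernel hf]
  refine norm_integral_le_of_norm_le hf'.norm (Filter.Eventually.of_forall fun ξ => ?_)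
  rw [mul_assoc, norm_wave_mul, norm_mul]
  refine mul_le_of_le_one_left (norm_nonneg _) ((norm_cutSymbol_le _ _ _).trans ?_)
  exact Set.indicator_le_self' (fun _ _ => zero_le_one) ξ

theorem Vop_eq (s : ℝ) (f : E2 → ℂ) (x : E2) :
    Vop s f x = ∫ ξ : E2, Complex.exp ((2 * π * inner ℝ ξ x : ℝ) * I) *
      (Complex.exp (Complex.I * s * ((ξ 0 : ℂ) ^ 3 + (ξ 1 : ℂ) ^ 3)) * 𝓕 f ξ) := by
  rw [Vop, fmul, Real.fourierInv_eq']
  simp [smul_eq_mul]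

/-- The group `V` is the limit of the truncated convolutions. -/
theorem tendsto_integral_mul_cutKernel {f : E2 → ℂ} (hf : Integrable f) (hf' : Integrable (𝓕 f))
    (s : ℝ) (x : E2) : Filter.Tendsto (fun n : ℕ => ∫ y, f y * cutKernel n (s, x - y))
      Filter.atTop (nhds (Vop s f x)) := by
  simp_rw [integral_mul_cutKernel hf, Vop_eq]
  refine tendsto_integral_of_dominated_convergence (fun ξ => ‖𝓕 f ξ‖) ?_ hf'.norm ?_ ?_
  · intro n
    exact (((Continuous.measurable (by fun_prop)).mul
      (measurable_cutSymbol _ _)).aestronglyMeasurable).mul hf'.aestronglyMeasurable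
  · intro n
    refine Filter.Eventually.of_forall fun ξ => ?_
    rw [mul_assoc, norm_wave_mul, norm_mul]
    refine mul_le_of_le_one_left (norm_nonneg _) ((norm_cutSymbol_le _ _ _).trans ?_)
    exact Set.indicator_le_self' (fun _ _ => zero_le_one) ξ
  · refine Filter.Eventually.of_forall fun ξ => ?_
    refine tendsto_const_nhds.congr' ?_
    obtain ⟨N, hN⟩ := exists_nat_ge (max |ξ 0| |ξ 1|)
    filter_upwards [Filter.eventually_ge_atTop N] with n hn
    have hn' : (N : ℝ) ≤ n := by exact_mod_cast hn
    have hmem : ξ ∈ freqBox n :=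
      ⟨(le_max_left _ _).trans (hN.trans hn'), (le_max_right _ _).trans (hN.trans hn')⟩
    rw [cutSymbol, Set.indicator_of_mem hmem]
    ring

/-- Outside the functions which are integrable together with their Fourier transform,
`V` vanishes identically. -/
theorem Vop_eq_zero {f : E2 → ℂ} (h : ¬ (Integrable f ∧ Integrable (𝓕 f))) (s : ℝ) (x : E2) :
    Vop s f x = 0 := by
  by_cases hf : Integrable f
  · have hf' : ¬ Integrable (𝓕 f) := fun h' => h ⟨hf, h'⟩
    rw [Vop_eq]
    refine integral_undef fun hi => hf' ?_
    have hc : Continuous (𝓕 f) := VectorFourier.fourierIntegral_continuous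
      Real.continuous_fourierChar continuous_inner hf
    refine hi.mono hc.aestronglyMeasurable (Filter.Eventually.of_forall fun ξ => ?_)
    rw [norm_wave_mul, norm_mul, norm_symbol, one_mul]
  · have : 𝓕 f = 0 := by
      ext ξ
      rw [Real.fourier_eq']
      refine integral_undef fun hi => hf ?_
      have := (Real.fourierIntegral_convergent_iff (μ := volume) (f := f) ξ).1
      apply this
      simpa [Circle.smul_def, Real.fourierChar_apply] using hi
    rw [Vop_eq, this]
    simp

theorem continuous_Vop (f : E2 → ℂ) : Continuous fun p : ℝ × E2 => Vop p.1 f p.2 := by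
  by_cases h : Integrable f ∧ Integrable (𝓕 f)
  · simp_rw [Vop_eq]
    refine continuous_of_dominated (bound := fun ξ => ‖𝓕 f ξ‖) ?_ ?_ h.2.norm ?_
    · intro p
      exact (Continuous.aestronglyMeasurable (by fun_prop)).mul
        ((Continuous.aestronglyMeasurable (by fun_prop)).mul h.2.aestronglyMeasurable)
    · intro p
      refine Filter.Eventually.of_forall fun ξ => ?_
      rw [norm_wave_mul, norm_mul, norm_symbol, one_mul]
    · refine Filter.Eventually.of_forall fun ξ => ?_
      fun_prop
  · simp_rw [Vop_eq_zero h]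
    exact continuous_const

/-- The norm of `L^{3/2}_τ L^1_x`. -/
def normL32L1 (ρ : ℝ × E2 → ℝ≥0∞) : ℝ≥0∞ :=
  (∫⁻ τ, (∫⁻ x, ρ (τ, x)) ^ (3/2 : ℝ)) ^ (2/3 : ℝ)

/-- The norm of `L^1_τ L^2_x`. -/
def normL1L2 (ρ : ℝ × E2 → ℝ≥0∞) : ℝ≥0∞ :=
  ∫⁻ τ, (∫⁻ x, ρ (τ, x) ^ 2) ^ (1/2 : ℝ)

theorem normL32L1_mono : Monotone normL32L1 := fun ρ σ h => by
  unfold normL32L1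
  gcongr with τ x
  exact h _

theorem normL1L2_mono : Monotone normL1L2 := fun ρ σ h => by
  unfold normL1L2
  gcongr with τ x
  exact h _

theorem lintegral_volume_prod {f : ℝ × E2 → ℝ≥0∞} (hf : Measurable f) :
    ∫⁻ z, f z = ∫⁻ τ, ∫⁻ x, f (τ, x) := by
  rw [Measure.volume_eq_prod, lintegral_prod _ hf.aemeasurable]

theorem iSup_min_natCast (x : ℝ≥0∞) : ⨆ n : ℕ, min x n = x := by
  rw [← inf_iSup_eq, ENNReal.iSup_natCast, inf_top_eq]

theorem monotone_indicator_min {α : Type*} (ρ : α → ℝ≥0∞) {Q : ℕ → Set α} (hQ : Monotone Q) :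
    Monotone fun n => (Q n).indicator fun z => min (ρ z) n := fun m n h z => by
  dsimp only
  by_cases hz : z ∈ Q m
  · rw [Set.indicator_of_mem hz, Set.indicator_of_mem (hQ h hz)]
    gcongr
  · rw [Set.indicator_of_notMem hz]
    exact zero_le

theorem iSup_indicator_min {α : Type*} (ρ : α → ℝ≥0∞) {Q : ℕ → Set α} (hQ : Monotone Q) {z : α}
    {k : ℕ} (hz : z ∈ Q k) : ⨆ n, (Q n).indicator (fun z => min (ρ z) n) z = ρ z := by
  apply le_antisymm
  · exact iSup_le fun n => (Set.indicator_le_self _ _ _).trans (min_le_left _ _)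
  · calc ρ z = ⨆ n : ℕ, min (ρ z) n := (iSup_min_natCast _).symm
      _ ≤ _ := iSup_le fun n => by
        refine le_iSup_of_le (max n k) ?_
        rw [Set.indicator_of_mem (hQ (le_max_right n k) hz)]
        gcongr
        exact le_max_left _ _

/-- In a duality estimate it suffices to test against bounded functions supported in an
exhausting sequence of sets. -/
theorem lintegral_mul_le_of_truncation {α : Type*} [MeasurableSpace α] {μ : Measure α}
    {N : (α → ℝ≥0∞) → ℝ≥0∞} (hN : Monotone N) {a : α → ℝ≥0∞} (ha : Measurable a)
    {Q : ℕ → Set α} (hQm : ∀ n, MeasurableSet (Q n)) (hQ : Monotone Q)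
    (hcov : ∀ z, a z ≠ 0 → ∃ n, z ∈ Q n) {B : ℝ≥0∞}
    (h : ∀ (n : ℕ) (ρ : α → ℝ≥0∞), Measurable ρ → (∀ z, ρ z ≤ n) → (∀ z ∉ Q n, ρ z = 0) →
      ∫⁻ z, a z * ρ z ∂μ ≤ B * N ρ) {ρ : α → ℝ≥0∞} (hρ : Measurable ρ) :
    ∫⁻ z, a z * ρ z ∂μ ≤ B * N ρ := by
  have hm : ∀ n : ℕ, Measurable ((Q n).indicator fun z => min (ρ z) n) := fun n =>
    (hρ.min measurable_const).indicator (hQm n)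
  have e : ∀ z, a z * ρ z = ⨆ n, a z * (Q n).indicator (fun z => min (ρ z) n) z := by
    intro z
    rw [← ENNReal.mul_iSup]
    by_cases hz : a z = 0
    · rw [hz, zero_mul, zero_mul]
    · obtain ⟨k, hk⟩ := hcov z hz
      rw [iSup_indicator_min ρ hQ hk]
  simp_rw [e]
  rw [lintegral_iSup (f := fun n z => a z * (Q n).indicator (fun z => min (ρ z) n) z)
    (fun n => ha.mul (hm n)) (fun m n hmn z =>
    mul_le_mul_right (monotone_indicator_min ρ hQ hmn z) _)]
  refine iSup_le fun n => (h n _ (hm n) (fun z => ?_) fun z hz => ?_).trans ?_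
  · exact (Set.indicator_le_self _ _ _).trans (min_le_right _ _)
  · exact Set.indicator_of_notMem hz _
  · gcongr
    exact hN fun z => (Set.indicator_le_self _ _ _).trans (min_le_left _ _)

/-- A converse of Hölder's inequality for the exponents `3` and `3/2`. -/
theorem lintegral_cube_le_of_dual {h : ℝ → ℝ≥0∞} (hh : Measurable h) {B : ℝ≥0∞}
    (hB : ∀ g : ℝ → ℝ≥0∞, Measurable g →
      ∫⁻ τ, g τ * h τ ≤ B * (∫⁻ τ, g τ ^ (3/2 : ℝ)) ^ (2/3 : ℝ)) :
    ∫⁻ τ, h τ ^ 3 ≤ B ^ 3 := by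
  set Q : ℕ → Set ℝ := fun n => Metric.closedBall 0 n with hQ
  have hQm : Monotone Q := fun m n hmn => Metric.closedBall_subset_closedBall (by exact_mod_cast hmn)
  set hn : ℕ → ℝ → ℝ≥0∞ := fun n => (Q n).indicator fun z => min (h z) n with hhn
  have hnm : ∀ n, Measurable (hn n) := fun n =>
    (hh.min measurable_const).indicator measurableSet_closedBall
  have hnle : ∀ n τ, hn n τ ≤ h τ := fun n τ =>
    (Set.indicator_le_self _ _ _).trans (min_le_left _ _)
  have hmono : Monotone hn := monotone_indicator_min h hQm
  have e : ∀ τ, h τ ^ 3 = ⨆ n, hn n τ ^ 3 := fun τ => by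
    obtain ⟨k, hk⟩ := exists_nat_ge ‖τ‖
    rw [← ENNReal.iSup_pow, iSup_indicator_min h hQm (k := k) (by simpa [hQ] using hk)]
  simp_rw [e]
  rw [lintegral_iSup (fun n => (hnm n).pow_const 3) fun m n hmn τ =>
    pow_le_pow_left' (hmono hmn τ) 3]
  refine iSup_le fun n => ?_
  set J := ∫⁻ τ, hn n τ ^ 3 with hJ
  have hJfin : J ≠ ∞ := by
    refine ne_of_lt ?_
    calc J ≤ ∫⁻ τ, (Q n).indicator (fun _ => (n : ℝ≥0∞) ^ 3) τ := by
          refine lintegral_mono fun τ => ?_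
          by_cases hτ : τ ∈ Q n
          · simp only [hhn, Set.indicator_of_mem hτ]
            gcongr
            exact min_le_right _ _
          · simp only [hhn, Set.indicator_of_notMem hτ]
            simp
      _ < ∞ := by
          rw [lintegral_indicator_const measurableSet_closedBall]
          exact ENNReal.mul_lt_top (ENNReal.pow_lt_top (ENNReal.natCast_lt_top n))
            measure_closedBall_lt_top
  rcases eq_or_ne J 0 with h0 | h0
  · rw [h0]; exact zero_le
  have key : J ≤ B * J ^ (2/3 : ℝ) := by
    calc J ≤ ∫⁻ τ, hn n τ ^ 2 * h τ := lintegral_mono fun τ => by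
          rw [pow_succ]
          gcongr
          exact hnle n τ
      _ ≤ B * (∫⁻ τ, (hn n τ ^ 2) ^ (3/2 : ℝ)) ^ (2/3 : ℝ) := hB _ ((hnm n).pow_const 2)
      _ = B * J ^ (2/3 : ℝ) := by
          congr 3 with τ
          rw [← ENNReal.rpow_natCast, ← ENNReal.rpow_mul, ← ENNReal.rpow_natCast]
          norm_num
  have h23 : J ^ (2/3 : ℝ) ≠ 0 := by simp [h0, hJfin]
  have h23' : J ^ (2/3 : ℝ) ≠ ∞ := by simp [h0, hJfin]
  have e2 : J = J ^ (1/3 : ℝ) * J ^ (2/3 : ℝ) := by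
    rw [← ENNReal.rpow_add _ _ h0 hJfin]; norm_num
  have key2 : J ^ (1/3 : ℝ) ≤ B := by
    rw [← ENNReal.mul_le_mul_iff_left h23 h23', ← e2]
    exact key
  calc J = (J ^ (1/3 : ℝ)) ^ 3 := by
        rw [← ENNReal.rpow_natCast, ← ENNReal.rpow_mul]; norm_num
    _ ≤ B ^ 3 := by gcongr

theorem measurable_essSup_section {a : ℝ × E2 → ℝ≥0∞} (ha : Measurable a) :
    Measurable fun τ => essSup (fun x => a (τ, x)) volume := by
  refine measurable_of_Iic fun c => ?_
  have : (fun τ => essSup (fun x => a (τ, x)) volume) ⁻¹' Set.Iic c =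
      (fun τ => volume (Prod.mk τ ⁻¹' {z | c < a z})) ⁻¹' {0} := by
    ext τ
    simp only [Set.mem_preimage, Set.mem_Iic, Set.mem_singleton_iff]
    constructor
    · intro h
      have := _root_.ae_le_essSup (f := fun x => a (τ, x)) (μ := volume)
      have h2 : ∀ᵐ x, a (τ, x) ≤ c := this.mono fun x hx => hx.trans h
      rw [ae_iff] at h2
      simpa [Set.preimage] using h2
    · intro h
      refine essSup_le_of_ae_le c ?_
      rw [Filter.EventuallyLE, ae_iff]
      simpa [Set.preimage] using h
  rw [this]
  exact measurable_measure_prodMk_left (measurableSet_lt measurable_const ha)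
    (measurableSet_singleton 0)

/-- Duality for `L^3_τ L^∞_x`. -/
theorem lintegral_essSup_cube_le_of_dual {a : ℝ × E2 → ℝ≥0∞} (ha : Measurable a) {B : ℝ≥0∞}
    (hB : ∀ ρ : ℝ × E2 → ℝ≥0∞, Measurable ρ → ∫⁻ z, a z * ρ z ≤ B * normL32L1 ρ) :
    ∫⁻ τ, essSup (fun x => a (τ, x)) volume ^ 3 ≤ (2 * B) ^ 3 := by
  set A : ℝ → ℝ≥0∞ := fun τ => essSup (fun x => a (τ, x)) volume with hA
  have hAm : Measurable A := measurable_essSup_section ha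
  obtain ⟨w, hwpos, hwm, hw1⟩ := exists_pos_lintegral_lt_of_sigmaFinite
    (volume : Measure E2) (ε := 1) one_ne_zero
  set b : ℕ → ℝ → ℝ≥0∞ := fun k τ => min (A τ / 2) k with hb
  have hbm : ∀ k, Measurable (b k) := fun k => (hAm.div_const 2).min measurable_const
  have hbk : ∀ k, ∫⁻ τ, b k τ ^ 3 ≤ B ^ 3 := by
    intro k
    refine lintegral_cube_le_of_dual (hbm k) fun g hg => ?_
    set E : Set (ℝ × E2) := {z | b k z.1 < a z} with hE
    have hEm : MeasurableSet E := measurableSet_lt ((hbm k).comp measurable_fst) ha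
    set v : ℝ × E2 → ℝ≥0∞ := E.indicator fun z => (w z.2 : ℝ≥0∞) with hv
    have hvm : Measurable v := (hwm.comp measurable_snd).coe_nnreal_ennreal.indicator hEm
    set e : ℝ → ℝ≥0∞ := fun τ => ∫⁻ x, v (τ, x) with he
    have hem : Measurable e := hvm.lintegral_prod_right'
    have hetop : ∀ τ, e τ ≠ ∞ := fun τ => ne_top_of_le_ne_top (hw1.trans one_lt_top).ne
      (lintegral_mono fun x => Set.indicator_le_self E (fun z : ℝ × E2 => (w z.2 : ℝ≥0∞)) (τ, x))
    have hepos : ∀ τ, A τ ≠ 0 → e τ ≠ 0 := by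
      intro τ hτ h0
      have hlt : b k τ < A τ := by
        rcases eq_or_ne (A τ) ∞ with ht | ht
        · rw [ht]
          exact (min_le_right _ _).trans_lt (ENNReal.natCast_lt_top k)
        · exact (min_le_left _ _).trans_lt (ENNReal.half_lt_self hτ ht)
      refine absurd ?_ (not_le.2 hlt)
      refine essSup_le_of_ae_le _ ?_
      have h1 := (lintegral_eq_zero_iff (hvm.comp measurable_prodMk_left)).1 h0
      filter_upwards [h1] with x hx
      by_contra hcon
      have hmem : (τ, x) ∈ E := not_le.1 hcon
      have : v (τ, x) = 0 := hx
      rw [hv, Set.indicator_of_mem hmem] at this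
      have hwx := hwpos x
      simp at this
      exact hwx.ne' this
    set ρ : ℝ × E2 → ℝ≥0∞ := fun z => g z.1 * (e z.1)⁻¹ * v z with hρ
    have hρm : Measurable ρ :=
      ((hg.comp measurable_fst).mul (hem.comp measurable_fst).inv).mul hvm
    have hsec : ∀ τ, ∫⁻ x, ρ (τ, x) = g τ * (e τ)⁻¹ * e τ := fun τ => by
      simp only [hρ]
      exact lintegral_const_mul _ (hvm.comp measurable_prodMk_left)
    have hsec_le : ∀ τ, ∫⁻ x, ρ (τ, x) ≤ g τ := fun τ => by
      rw [hsec, mul_assoc]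
      exact mul_le_of_le_one_right' (ENNReal.inv_mul_le_one _)
    calc ∫⁻ τ, g τ * b k τ ≤ ∫⁻ τ, ∫⁻ x, a (τ, x) * ρ (τ, x) := by
          refine lintegral_mono fun τ => ?_
          by_cases hτ : A τ = 0
          · simp [hb, hτ]
          calc g τ * b k τ = b k τ * ∫⁻ x, ρ (τ, x) := by
                rw [hsec, mul_assoc, ENNReal.inv_mul_cancel (hepos τ hτ) (hetop τ), mul_one,
                  mul_comm]
            _ = ∫⁻ x, b k τ * ρ (τ, x) :=
                (lintegral_const_mul _ (hρm.comp measurable_prodMk_left)).symm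
            _ ≤ _ := by
                refine lintegral_mono fun x => ?_
                by_cases hmem : (τ, x) ∈ E
                · dsimp only
                  gcongr
                  exact le_of_lt hmem
                · simp [hρ, hv, Set.indicator_of_notMem hmem]
      _ = ∫⁻ z, a z * ρ z := (lintegral_volume_prod (ha.mul hρm)).symm
      _ ≤ B * normL32L1 ρ := hB ρ hρm
      _ ≤ _ := by
          unfold normL32L1
          gcongr with τ
          exact hsec_le τ
  have e : ∀ τ, A τ ^ 3 = 2 ^ 3 * ⨆ k, b k τ ^ 3 := fun τ => by
    rw [← ENNReal.iSup_pow, iSup_min_natCast, ← mul_pow,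
      ENNReal.mul_div_cancel (by norm_num) (by norm_num)]
  calc ∫⁻ τ, A τ ^ 3 = 2 ^ 3 * ∫⁻ τ, ⨆ k, b k τ ^ 3 := by
        simp_rw [e]
        rw [lintegral_const_mul _ (Measurable.iSup fun k => (hbm k).pow_const 3)]
    _ ≤ 2 ^ 3 * B ^ 3 := by
        gcongr
        rw [lintegral_iSup (fun k => (hbm k).pow_const 3) fun m n hmn τ => by
          simp only [hb]
          gcongr]
        exact iSup_le hbk
    _ = _ := (mul_pow _ _ _).symm

/-- Duality for `L^∞_τ L^2_x`. -/
theorem ae_lintegral_sq_le_of_dual {a : ℝ × E2 → ℝ≥0∞} (ha : Measurable a) {B : ℝ≥0∞}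
    (hB : ∀ ρ : ℝ × E2 → ℝ≥0∞, Measurable ρ → ∫⁻ z, a z * ρ z ≤ B * normL1L2 ρ) :
    ∀ᵐ τ : ℝ, ∫⁻ x, a (τ, x) ^ 2 ≤ B ^ 2 := by
  set Q : ℕ → Set (ℝ × E2) := fun n => {z | ‖z.2‖ ≤ n} with hQ
  have hQmeas : ∀ n, MeasurableSet (Q n) := fun n =>
    measurableSet_le (by fun_prop) measurable_const
  have hQm : Monotone Q := fun m n hmn z hz => le_trans (show ‖z.2‖ ≤ m from hz)
    (by exact_mod_cast hmn)
  set an : ℕ → ℝ × E2 → ℝ≥0∞ := fun n => (Q n).indicator fun z => min (a z) n with han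
  have hanm : ∀ n, Measurable (an n) := fun n =>
    (ha.min measurable_const).indicator (hQmeas n)
  have hanle : ∀ n z, an n z ≤ a z := fun n z =>
    (Set.indicator_le_self _ _ _).trans (min_le_left _ _)
  have hmono : Monotone an := monotone_indicator_min a hQm
  set s : ℕ → ℝ → ℝ≥0∞ := fun n τ => ∫⁻ x, an n (τ, x) ^ 2 with hs
  have hsm : ∀ n, Measurable (s n) := fun n => ((hanm n).pow_const 2).lintegral_prod_right'
  have hsfin : ∀ n τ, s n τ ≠ ∞ := fun n τ => by
    refine ne_of_lt ?_
    calc s n τ ≤ ∫⁻ x : E2, (Metric.closedBall (0 : E2) n).indicator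
            (fun _ => (n : ℝ≥0∞) ^ 2) x := by
          refine lintegral_mono fun x => ?_
          by_cases hx : (τ, x) ∈ Q n
          · have hx' : x ∈ Metric.closedBall (0 : E2) n := by simpa [hQ] using hx
            simp only [han, Set.indicator_of_mem hx, Set.indicator_of_mem hx']
            gcongr
            exact min_le_right _ _
          · simp only [han, Set.indicator_of_notMem hx]
            simp
      _ < ∞ := by
          rw [lintegral_indicator_const measurableSet_closedBall]
          exact ENNReal.mul_lt_top (ENNReal.pow_lt_top (ENNReal.natCast_lt_top n))
            measure_closedBall_lt_top
  have hsB : ∀ n, ∀ᵐ τ : ℝ, s n τ ^ (1/2 : ℝ) ≤ B := by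
    intro n
    refine ae_le_of_forall_setLIntegral_le_of_sigmaFinite ((hsm n).pow_const _)
      fun S hS _ => ?_
    set ρ : ℝ × E2 → ℝ≥0∞ := fun z =>
      S.indicator (fun τ => s n τ ^ (-(1/2) : ℝ)) z.1 * an n z with hρ
    have hcm : Measurable (S.indicator fun τ => s n τ ^ (-(1/2) : ℝ)) :=
      ((hsm n).pow_const _).indicator hS
    have hρm : Measurable ρ := (hcm.comp measurable_fst).mul (hanm n)
    calc ∫⁻ τ in S, s n τ ^ (1/2 : ℝ) = ∫⁻ τ, S.indicator (fun τ => s n τ ^ (1/2 : ℝ)) τ :=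
          (lintegral_indicator hS _).symm
      _ ≤ ∫⁻ τ, ∫⁻ x, a (τ, x) * ρ (τ, x) := by
          refine lintegral_mono fun τ => ?_
          by_cases hτ : τ ∈ S
          · simp only [hρ, Set.indicator_of_mem hτ]
            calc s n τ ^ (1/2 : ℝ) ≤ s n τ ^ (-(1/2) : ℝ) * s n τ := by
                  rcases eq_or_ne (s n τ) 0 with h0 | h0
                  · rw [h0]; simp
                  · nth_rewrite 3 [← ENNReal.rpow_one (s n τ)]
                    rw [← ENNReal.rpow_add _ _ h0 (hsfin n τ)]
                    norm_num
              _ = ∫⁻ x, s n τ ^ (-(1/2) : ℝ) * an n (τ, x) ^ 2 :=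
                  (lintegral_const_mul _ (((hanm n).pow_const 2).comp
                    measurable_prodMk_left)).symm
              _ ≤ _ := lintegral_mono fun x => by
                  dsimp only
                  rw [mul_left_comm, sq]
                  gcongr
                  exact hanle n _
          · rw [Set.indicator_of_notMem hτ]
            exact zero_le
      _ = ∫⁻ z, a z * ρ z := (lintegral_volume_prod (ha.mul hρm)).symm
      _ ≤ B * normL1L2 ρ := hB ρ hρm
      _ ≤ B * ∫⁻ τ, S.indicator (fun _ => 1) τ := by
          unfold normL1L2
          gcongr with τ
          simp only [hρ, mul_pow]
          rw [lintegral_const_mul (f := fun x => an n (τ, x) ^ 2) _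
            (((hanm n).pow_const 2).comp measurable_prodMk_left)]
          by_cases hτ : τ ∈ S
          · simp only [Set.indicator_of_mem hτ]
            rw [← ENNReal.rpow_natCast, ← ENNReal.rpow_mul]
            refine (ENNReal.rpow_le_rpow (z := 1/2) (y := 1) ?_ (by norm_num)).trans_eq
              (ENNReal.one_rpow _)
            norm_num
            rw [ENNReal.rpow_neg_one]
            exact ENNReal.inv_mul_le_one _
          · simp only [Set.indicator_of_notMem hτ]
            simp
      _ = ∫⁻ τ in S, B := by
          rw [lintegral_indicator hS]
          simp
  rw [← ae_all_iff] at hsB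
  filter_upwards [hsB] with τ hτ
  have e : ∀ x, a (τ, x) ^ 2 = ⨆ n, an n (τ, x) ^ 2 := fun x => by
    obtain ⟨k, hk⟩ := exists_nat_ge ‖x‖
    rw [← ENNReal.iSup_pow, iSup_indicator_min a hQm (k := k) (by simpa [hQ] using hk)]
  simp_rw [e]
  rw [lintegral_iSup (f := fun n x => an n (τ, x) ^ 2)
    (fun n => ((hanm n).pow_const 2).comp measurable_prodMk_left)
    fun m n hmn x => pow_le_pow_left' (hmono hmn _) 2]
  refine iSup_le fun n => ?_
  calc s n τ = (s n τ ^ (1/2 : ℝ)) ^ 2 := by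
        rw [← ENNReal.rpow_natCast, ← ENNReal.rpow_mul]; norm_num
    _ ≤ B ^ 2 := by gcongr; exact hτ n

theorem lintegral_mul_le_normL1L2 {f g : ℝ × E2 → ℝ≥0∞} (hf : Measurable f) (hg : Measurable g)
    {A : ℝ≥0∞} (h : ∀ τ, ∫⁻ x, g (τ, x) ^ 2 ≤ A ^ 2) :
    ∫⁻ z, f z * g z ≤ normL1L2 f * A := by
  rw [lintegral_volume_prod (f := fun z => f z * g z) (hf.mul hg), normL1L2, ← lintegral_mul_const _
    ((hf.pow_const 2).lintegral_prod_right'.pow_const _)]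
  refine lintegral_mono fun τ => ?_
  have h1 := ENNReal.lintegral_mul_le_Lp_mul_Lq (μ := (volume : Measure E2))
    (p := 2) (q := 2) (by rw [Real.holderConjugate_iff]; norm_num)
    (f := fun x => f (τ, x)) (g := fun x => g (τ, x))
    (hf.comp measurable_prodMk_left).aemeasurable (hg.comp measurable_prodMk_left).aemeasurable
  simp only [ENNReal.rpow_two] at h1
  refine h1.trans ?_
  gcongr
  calc (∫⁻ x, g (τ, x) ^ 2) ^ (1/2 : ℝ) ≤ (A ^ 2) ^ (1/2 : ℝ) := by gcongr; exact h τ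
    _ = A := by rw [← ENNReal.rpow_natCast, ← ENNReal.rpow_mul]; norm_num

theorem lintegral_dispersive_le {f g : ℝ × E2 → ℝ≥0∞} (hf : Measurable f) (hg : Measurable g) :
    ∫⁻ w, (∫⁻ z, 324 * ‖w.1 - z.1‖ₑ ^ (-(2/3) : ℝ) * f z) * g w ≤
      5184 * (normL32L1 f * normL32L1 g) := by
  have hk : Measurable fun p : ℝ × ℝ => ‖p.1 - p.2‖ₑ ^ (-(2/3) : ℝ) := by fun_prop
  set P : ℝ → ℝ≥0∞ := fun τ => ∫⁻ x, f (τ, x) with hP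
  set G : ℝ → ℝ≥0∞ := fun τ => ∫⁻ x, g (τ, x) with hG
  have hPm : Measurable P := hf.lintegral_prod_right'
  have hGm : Measurable G := hg.lintegral_prod_right'
  have inner : ∀ t : ℝ, ∫⁻ z : ℝ × E2, 324 * ‖t - z.1‖ₑ ^ (-(2/3) : ℝ) * f z =
      ∫⁻ τ, 324 * ‖t - τ‖ₑ ^ (-(2/3) : ℝ) * P τ := by
    intro t
    rw [lintegral_volume_prod (by fun_prop)]
    refine lintegral_congr fun τ => ?_
    dsimp only
    rw [lintegral_const_mul (f := fun x => f (τ, x)) _ (hf.comp measurable_prodMk_left)]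
  have hJ : Measurable fun t => ∫⁻ τ, 324 * ‖t - τ‖ₑ ^ (-(2/3) : ℝ) * P τ := by
    apply Measurable.lintegral_prod_right'
      (f := fun p : ℝ × ℝ => 324 * ‖p.1 - p.2‖ₑ ^ (-(2/3) : ℝ) * P p.2)
    fun_prop
  simp_rw [inner]
  rw [lintegral_volume_prod (by fun_prop)]
  calc _ = ∫⁻ t, ∫⁻ τ, 324 * (G t * P τ * ‖t - τ‖ₑ ^ (-(2/3) : ℝ)) := by
        refine lintegral_congr fun t => ?_
        dsimp only
        rw [lintegral_const_mul (f := fun x => g (t, x)) _ (hg.comp measurable_prodMk_left),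
          ← lintegral_mul_const _ (by fun_prop)]
        refine lintegral_congr fun τ => ?_
        simp only [hG]
        ring
    _ = 324 * ∫⁻ t, ∫⁻ τ, G t * P τ * ‖t - τ‖ₑ ^ (-(2/3) : ℝ) := by
        rw [← lintegral_const_mul']
        · refine lintegral_congr fun t => ?_
          exact lintegral_const_mul _ (by fun_prop)
        · norm_num
    _ ≤ 324 * (16 * (normL32L1 g * normL32L1 f)) := by
        gcongr
        exact lintegral_riesz_le hGm hPm
    _ = _ := by
        rw [← mul_assoc, mul_comm (normL32L1 g)]
        norm_num

/-- The space-time convolution operator with kernel `K`, restricted to those pairs of source and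
target times which belong to `Λ`. -/
def kernelOp (K : ℝ × E2 → ℂ) (Λ : Set (ℝ × ℝ)) (ψ : ℝ × E2 → ℂ) (w : ℝ × E2) : ℂ :=
  ∫ z : ℝ × E2, Λ.indicator (fun _ => (1 : ℂ)) (z.1, w.1) * K (w - z) * ψ z

theorem enorm_indicator_one_le {α : Type*} (s : Set α) (x : α) :
    ‖s.indicator (fun _ => (1 : ℂ)) x‖ₑ ≤ 1 := by
  by_cases h : x ∈ s
  · simp [h]
  · simp [h]

section kernelOp

variable {K : ℝ × E2 → ℂ} {Λ : Set (ℝ × ℝ)} {ψ : ℝ × E2 → ℂ}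

theorem measurable_kernelOp_integrand (hK : IsDispersive K) (hΛ : MeasurableSet Λ)
    (hψ : Measurable ψ) : Measurable fun p : (ℝ × E2) × (ℝ × E2) =>
      Λ.indicator (fun _ => (1 : ℂ)) (p.2.1, p.1.1) * K (p.1 - p.2) * ψ p.2 := by
  have h1 : Measurable (Λ.indicator fun _ => (1 : ℂ)) := measurable_const.indicator hΛ
  have h2 : Measurable K := hK.continuous.measurable
  exact ((h1.comp (by fun_prop)).mul (h2.comp (by fun_prop))).mul (hψ.comp measurable_snd)

theorem measurable_kernelOp (hK : IsDispersive K) (hΛ : MeasurableSet Λ) (hψ : Measurable ψ) :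
    Measurable (kernelOp K Λ ψ) :=
  (measurable_kernelOp_integrand hK hΛ hψ).stronglyMeasurable.integral_prod_right.measurable

theorem enorm_kernelOp_le (w : ℝ × E2) :
    ‖kernelOp K Λ ψ w‖ₑ ≤ ∫⁻ z, ‖K (w - z)‖ₑ * ‖ψ z‖ₑ := by
  refine (enorm_integral_le_lintegral_enorm _).trans (lintegral_mono fun z => ?_)
  rw [enorm_mul, enorm_mul]
  gcongr
  exact mul_le_of_le_one_left' (enorm_indicator_one_le _ _)

theorem enorm_kernelOp_le_of_bounded {B : ℝ≥0∞} (hB : ∀ z, ‖K z‖ₑ ≤ B) (hψ : Measurable ψ)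
    (w : ℝ × E2) : ‖kernelOp K Λ ψ w‖ₑ ≤ B * ∫⁻ z, ‖ψ z‖ₑ := by
  rw [← lintegral_const_mul _ hψ.enorm]
  refine (enorm_kernelOp_le w).trans (lintegral_mono fun z => ?_)
  dsimp only
  gcongr
  exact hB _

theorem IsDispersive.exists_enorm_le (hK : IsDispersive K) :
    ∃ B : ℝ≥0∞, B ≠ ∞ ∧ ∀ z, ‖K z‖ₑ ≤ B := by
  obtain ⟨B, hB⟩ := hK.bounded
  exact ⟨ENNReal.ofReal B, ENNReal.ofReal_ne_top, fun z => by
    rw [← ofReal_norm]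
    exact ENNReal.ofReal_le_ofReal (hB z)⟩

theorem lintegral_enorm_kernelOp_mul_le (hK : IsDispersive K) (hψ : Measurable ψ)
    {ρ : ℝ × E2 → ℝ≥0∞} (hρ : Measurable ρ) :
    ∫⁻ w, ‖kernelOp K Λ ψ w‖ₑ * ρ w ≤
      5184 * (normL32L1 (fun z => ‖ψ z‖ₑ) * normL32L1 ρ) := by
  refine le_trans (lintegral_mono fun w => ?_) (lintegral_dispersive_le hψ.enorm hρ)
  dsimp only
  gcongr
  refine (enorm_kernelOp_le w).trans (lintegral_mono fun z => ?_)
  dsimp only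
  gcongr
  exact hK.decay (w - z)

open scoped ComplexConjugate in
/-- The transpose of a space-time convolution operator. -/
theorem integral_kernelOp_mul (hK : IsDispersive K) (hΛ : MeasurableSet Λ) (hψ : Measurable ψ)
    (hψi : Integrable ψ) {F : ℝ × E2 → ℂ} (hF : Measurable F) (hFi : Integrable F) :
    ∫ w, kernelOp K Λ ψ w * F w =
      ∫ z, ψ z * kernelOp (fun z => conj (K z)) (Prod.swap ⁻¹' Λ) F z := by
  obtain ⟨B, hB⟩ := hK.bounded
  have hint : Integrable (fun p : (ℝ × E2) × (ℝ × E2) =>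
      Λ.indicator (fun _ => (1 : ℂ)) (p.2.1, p.1.1) * K (p.1 - p.2) * ψ p.2 * F p.1)
      ((volume : Measure (ℝ × E2)).prod volume) := by
    refine ((hFi.norm.mul_prod hψi.norm).const_mul B).mono'
      ((measurable_kernelOp_integrand hK hΛ hψ).mul (hF.comp measurable_fst)).aestronglyMeasurable
      (Filter.Eventually.of_forall fun p => ?_)
    rw [norm_mul, norm_mul, norm_mul]
    have h1 : ‖Λ.indicator (fun _ => (1 : ℂ)) (p.2.1, p.1.1)‖ ≤ 1 := by
      by_cases h : (p.2.1, p.1.1) ∈ Λ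
      · simp [h]
      · simp [h]
    have h2 := hB (p.1 - p.2)
    have h3 : ‖Λ.indicator (fun _ => (1 : ℂ)) (p.2.1, p.1.1)‖ * ‖K (p.1 - p.2)‖ ≤ B :=
      (mul_le_of_le_one_left (norm_nonneg _) h1).trans h2
    calc _ ≤ B * ‖ψ p.2‖ * ‖F p.1‖ := by gcongr
      _ = _ := by ring
  calc ∫ w, kernelOp K Λ ψ w * F w = ∫ w, ∫ z,
        Λ.indicator (fun _ => (1 : ℂ)) (z.1, w.1) * K (w - z) * ψ z * F w := by
        congr 1 with w
        rw [kernelOp, integral_mul_const]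
    _ = ∫ z, ∫ w, Λ.indicator (fun _ => (1 : ℂ)) (z.1, w.1) * K (w - z) * ψ z * F w :=
        integral_integral_swap hint
    _ = _ := by
        congr 1 with z
        rw [kernelOp, ← integral_const_mul]
        congr 1 with w
        rw [← hK.conj_symm, neg_sub]
        have : (Prod.swap ⁻¹' Λ).indicator (fun _ => (1 : ℂ)) (w.1, z.1) =
          Λ.indicator (fun _ => (1 : ℂ)) (z.1, w.1) := rfl
        rw [this]
        ring

open scoped ComplexConjugate in
/-- The `TT*` identity at a fixed time. -/
theorem lintegral_kernelOp_univ_sq_le (hK : IsDispersive K) (hψ : Measurable ψ)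
    (hψi : Integrable ψ) (t : ℝ) :
    ∫⁻ y, ‖kernelOp K Set.univ ψ (t, y)‖ₑ ^ 2 ≤
      ∫⁻ z, ‖ψ z‖ₑ * ‖kernelOp K Set.univ ψ z‖ₑ := by
  set u := kernelOp K Set.univ ψ with hu
  have hK' : Measurable K := hK.continuous.measurable
  have hueq : ∀ w, u w = ∫ z, K (w - z) * ψ z := fun w => by simp [hu, kernelOp]
  obtain ⟨D, hD, hDb⟩ := hK.square
  obtain ⟨B, hB⟩ := hK.bounded
  set G : E2 × ((ℝ × E2) × (ℝ × E2)) → ℂ := fun p =>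
    (K ((t, p.1) - p.2.1) * ψ p.2.1) * conj (K ((t, p.1) - p.2.2) * ψ p.2.2) with hG
  have hGm : Measurable G := by
    have h1 : Measurable fun p : E2 × ((ℝ × E2) × (ℝ × E2)) => K ((t, p.1) - p.2.1) :=
      hK'.comp (by fun_prop)
    have h2 : Measurable fun p : E2 × ((ℝ × E2) × (ℝ × E2)) => K ((t, p.1) - p.2.2) :=
      hK'.comp (by fun_prop)
    exact (h1.mul (hψ.comp (by fun_prop))).mul
      (Complex.continuous_conj.measurable.comp (h2.mul (hψ.comp (by fun_prop))))
  have hGi : Integrable G ((volume : Measure E2).prod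
      ((volume : Measure (ℝ × E2)).prod (volume : Measure (ℝ × E2)))) := by
    refine ⟨hGm.aestronglyMeasurable, ?_⟩
    rw [hasFiniteIntegral_iff_enorm, lintegral_prod_symm' _ hGm.enorm]
    have hsq : ∀ z : ℝ × E2, ∫⁻ y : E2, ‖K ((t, y) - z)‖ₑ ^ 2 ≤ D := fun z => by
      have := lintegral_sub_right_eq_self (μ := (volume : Measure E2))
        (fun y => ‖K (t - z.1, y)‖ₑ ^ 2) z.2
      calc _ = ∫⁻ y : E2, ‖K (t - z.1, y - z.2)‖ₑ ^ 2 := rfl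
        _ ≤ D := this.trans_le (hDb _)
    have hin : ∀ p : (ℝ × E2) × (ℝ × E2), ∫⁻ y, ‖G (y, p)‖ₑ ≤ (2 * D) * (‖ψ p.1‖ₑ * ‖ψ p.2‖ₑ) := by
      intro p
      have hm : Measurable fun y : E2 => ‖K ((t, y) - p.1)‖ₑ := (hK'.comp (by fun_prop)).enorm
      calc ∫⁻ y, ‖G (y, p)‖ₑ ≤ ∫⁻ y, (‖K ((t, y) - p.1)‖ₑ ^ 2 + ‖K ((t, y) - p.2)‖ₑ ^ 2) *
            (‖ψ p.1‖ₑ * ‖ψ p.2‖ₑ) := lintegral_mono fun y => by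
              simp only [hG]
              rw [enorm_mul, enorm_mul, enorm_eq_nnnorm (conj _), RCLike.nnnorm_conj,
                ← enorm_eq_nnnorm, enorm_mul, mul_mul_mul_comm]
              gcongr
              generalize ‖K ((t, y) - p.1)‖ₑ = a
              generalize ‖K ((t, y) - p.2)‖ₑ = b
              rcases le_total a b with h | h
              · calc a * b ≤ b * b := by gcongr
                  _ = b ^ 2 := (sq b).symm
                  _ ≤ _ := le_add_self
              · calc a * b ≤ a * a := by gcongr
                  _ = a ^ 2 := (sq a).symm
                  _ ≤ _ := le_self_add
        _ = ((∫⁻ y, ‖K ((t, y) - p.1)‖ₑ ^ 2) + ∫⁻ y, ‖K ((t, y) - p.2)‖ₑ ^ 2) *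
            (‖ψ p.1‖ₑ * ‖ψ p.2‖ₑ) := by
              rw [lintegral_mul_const' _ _ (by finiteness), lintegral_add_left (hm.pow_const 2)]
        _ ≤ (D + D) * (‖ψ p.1‖ₑ * ‖ψ p.2‖ₑ) := by
              gcongr
              · exact hsq _
              · exact hsq _
        _ = _ := by rw [two_mul]
    have hψ2 : ∫⁻ z, ‖ψ z‖ₑ ≠ ∞ := hψi.2.ne
    calc _ ≤ ∫⁻ p : (ℝ × E2) × (ℝ × E2), (2 * D) * (‖ψ p.1‖ₑ * ‖ψ p.2‖ₑ)
          ∂((volume : Measure (ℝ × E2)).prod volume) := lintegral_mono hin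
      _ = (2 * D) * ((∫⁻ z, ‖ψ z‖ₑ) * ∫⁻ z, ‖ψ z‖ₑ) := by
          rw [lintegral_const_mul' _ _ (by finiteness),
            lintegral_prod_mul hψ.enorm.aemeasurable hψ.enorm.aemeasurable]
      _ < ∞ := by finiteness
  have hyp : ∀ y, ∫ p, G (y, p) ∂((volume : Measure (ℝ × E2)).prod volume) =
      u (t, y) * conj (u (t, y)) := fun y => by
    rw [hueq, ← integral_conj, ← integral_prod_mul]
  have hui : Integrable fun y => u (t, y) * conj (u (t, y)) := by
    have := hGi.integral_prod_left
    simpa only [hyp] using this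
  have hint2 : Integrable (fun p : (ℝ × E2) × (ℝ × E2) => K (p.1 - p.2) * ψ p.2 * conj (ψ p.1))
      ((volume : Measure (ℝ × E2)).prod volume) := by
    refine ((hψi.norm.mul_prod hψi.norm).const_mul B).mono'
      (((hK'.comp (by fun_prop)).mul (hψ.comp (by fun_prop))).mul
        (Complex.continuous_conj.measurable.comp (hψ.comp measurable_fst))).aestronglyMeasurable
      (Filter.Eventually.of_forall fun p => ?_)
    rw [norm_mul, norm_mul, RCLike.norm_conj]
    calc _ ≤ B * ‖ψ p.2‖ * ‖ψ p.1‖ := by gcongr; exact hB _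
      _ = _ := by ring
  have main : ∫ y, u (t, y) * conj (u (t, y)) = ∫ z', u z' * conj (ψ z') := by
    simp_rw [← hyp]
    rw [integral_integral_swap (f := fun y p => G (y, p)) hGi]
    calc _ = ∫ p : (ℝ × E2) × (ℝ × E2), K (p.2 - p.1) * ψ p.1 * conj (ψ p.2)
          ∂((volume : Measure (ℝ × E2)).prod volume) := by
          congr 1 with p
          have hc := hK.composition (t - p.1.1) (t - p.2.1) p.1.2 p.2.2
          rw [_root_.sub_sub_sub_cancel_left] at hc
          calc ∫ y, G (y, p) = ∫ y, (K (t - p.1.1, y - p.1.2) * conj (K (t - p.2.1, y - p.2.2))) *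
                (ψ p.1 * conj (ψ p.2)) := by
                congr 1 with y
                simp only [hG, map_mul]
                have e1 : ((t, y) : ℝ × E2) - p.1 = (t - p.1.1, y - p.1.2) := rfl
                have e2 : ((t, y) : ℝ × E2) - p.2 = (t - p.2.1, y - p.2.2) := rfl
                rw [e1, e2]
                ring
            _ = K (p.2 - p.1) * (ψ p.1 * conj (ψ p.2)) := by
                rw [integral_mul_const, hc]
                rfl
            _ = _ := by ring
      _ = ∫ p : (ℝ × E2) × (ℝ × E2), K (p.1 - p.2) * ψ p.2 * conj (ψ p.1)
          ∂((volume : Measure (ℝ × E2)).prod volume) :=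
          integral_prod_swap (fun p : (ℝ × E2) × (ℝ × E2) =>
            K (p.1 - p.2) * ψ p.2 * conj (ψ p.1))
      _ = ∫ z', ∫ z, K (z' - z) * ψ z * conj (ψ z') := integral_prod _ hint2
      _ = _ := by
          congr 1 with z'
          rw [integral_mul_const, hueq]
  have hre : ∀ y, u (t, y) * conj (u (t, y)) = ((‖u (t, y)‖ ^ 2 : ℝ) : ℂ) := fun y => by
    rw [Complex.mul_conj, Complex.normSq_eq_norm_sq]
  have hi3 : Integrable fun y => ‖u (t, y)‖ ^ 2 := by
    have := hui.norm
    simpa [hre] using this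
  have hcal : ((∫ y, ‖u (t, y)‖ ^ 2 : ℝ) : ℂ) = ∫ z', u z' * conj (ψ z') := by
    rw [← main, ← integral_complex_ofReal]
    simp_rw [hre]
  calc ∫⁻ y, ‖u (t, y)‖ₑ ^ 2 = ∫⁻ y, ENNReal.ofReal (‖u (t, y)‖ ^ 2) := by
        congr 1 with y
        rw [ENNReal.ofReal_pow (norm_nonneg _), ofReal_norm]
    _ = ENNReal.ofReal (∫ y, ‖u (t, y)‖ ^ 2) :=
        (ofReal_integral_eq_lintegral_ofReal hi3
          (Filter.Eventually.of_forall fun _ => by positivity)).symm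
    _ ≤ ‖((∫ y, ‖u (t, y)‖ ^ 2 : ℝ) : ℂ)‖ₑ := by
        rw [← ofReal_norm, Complex.norm_real]
        exact ENNReal.ofReal_le_ofReal (le_abs_self _)
    _ ≤ ∫⁻ z', ‖u z' * conj (ψ z')‖ₑ := by
        rw [hcal]
        exact enorm_integral_le_lintegral_enorm _
    _ = _ := by
        congr 1 with z'
        rw [enorm_mul, mul_comm, enorm_eq_nnnorm (conj _), RCLike.nnnorm_conj, ← enorm_eq_nnnorm]

end kernelOp

open scoped ComplexConjugate in
/-- The function with modulus `ρ` and the phase conjugate to that of `u`. -/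
def dualPhase (u : ℝ × E2 → ℂ) (ρ : ℝ × E2 → ℝ≥0∞) (z : ℝ × E2) : ℂ :=
  ((ρ z).toReal : ℂ) * (conj (u z) / ‖u z‖)

theorem measurable_dualPhase {u : ℝ × E2 → ℂ} {ρ : ℝ × E2 → ℝ≥0∞} (hu : Measurable u)
    (hρ : Measurable ρ) : Measurable (dualPhase u ρ) :=
  (Complex.measurable_ofReal.comp hρ.ennreal_toReal).mul
    ((Complex.continuous_conj.measurable.comp hu).div
      (Complex.measurable_ofReal.comp hu.norm))

theorem enorm_dualPhase_le (u : ℝ × E2 → ℂ) (ρ : ℝ × E2 → ℝ≥0∞) (z : ℝ × E2) :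
    ‖dualPhase u ρ z‖ₑ ≤ ρ z := by
  have h1 : ‖dualPhase u ρ z‖ ≤ (ρ z).toReal := by
    rw [dualPhase, norm_mul, norm_div, RCLike.norm_conj, Complex.norm_real, Complex.norm_real,
      norm_norm, Real.norm_of_nonneg ENNReal.toReal_nonneg]
    exact mul_le_of_le_one_right ENNReal.toReal_nonneg (div_self_le_one _)
  rw [← ofReal_norm]
  exact (ENNReal.ofReal_le_ofReal h1).trans ENNReal.ofReal_toReal_le

theorem mul_dualPhase (u : ℝ × E2 → ℂ) (ρ : ℝ × E2 → ℝ≥0∞) (z : ℝ × E2) :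
    u z * dualPhase u ρ z = ((‖u z‖ * (ρ z).toReal : ℝ) : ℂ) := by
  rw [dualPhase, mul_left_comm, mul_div_assoc', Complex.mul_conj, Complex.normSq_eq_norm_sq]
  by_cases h : u z = 0
  · simp [h]
  · have : (‖u z‖ : ℂ) ≠ 0 := by simpa using h
    push_cast
    field_simp

theorem lintegral_enorm_mul_eq {u : ℝ × E2 → ℂ} {ρ : ℝ × E2 → ℝ≥0∞} (hρ : ∀ z, ρ z ≠ ∞)
    (hi : Integrable fun z => u z * dualPhase u ρ z) :
    ∫⁻ z, ‖u z‖ₑ * ρ z = ‖∫ z, u z * dualPhase u ρ z‖ₑ := by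
  simp_rw [mul_dualPhase] at hi ⊢
  have hi' : Integrable fun z => ‖u z‖ * (ρ z).toReal := by
    have := hi.re
    simpa using this
  rw [integral_complex_ofReal, ← ofReal_norm, Complex.norm_real, Real.norm_of_nonneg
    (integral_nonneg fun z => mul_nonneg (norm_nonneg _) ENNReal.toReal_nonneg),
    ofReal_integral_eq_lintegral_ofReal hi' (Filter.Eventually.of_forall fun z =>
      mul_nonneg (norm_nonneg _) ENNReal.toReal_nonneg)]
  refine lintegral_congr fun z => ?_
  rw [ENNReal.ofReal_mul (norm_nonneg _), ofReal_norm, ENNReal.ofReal_toReal (hρ z)]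

theorem integrable_of_enorm_le_natCast {ψ : ℝ × E2 → ℂ} (hψ : Measurable ψ) {n : ℕ}
    {s : Set (ℝ × E2)} (hs : volume s ≠ ∞) (h : ∀ z, ‖ψ z‖ₑ ≤ n) (h0 : ∀ z ∉ s, ψ z = 0) :
    Integrable ψ := by
  refine ⟨hψ.aestronglyMeasurable, ?_⟩
  rw [hasFiniteIntegral_iff_enorm]
  calc ∫⁻ z, ‖ψ z‖ₑ ≤ ∫⁻ z, s.indicator (fun _ => (n : ℝ≥0∞)) z := by
        refine lintegral_mono fun z => ?_
        by_cases hz : z ∈ s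
        · rw [Set.indicator_of_mem hz]; exact h z
        · simp [h0 z hz]
    _ ≤ n * volume s := lintegral_indicator_const_le _ _
    _ < ∞ := by finiteness

section kernelOp

variable {K : ℝ × E2 → ℂ} {Λ : Set (ℝ × ℝ)} {ψ : ℝ × E2 → ℂ}

theorem kernelOp_eq_univ (t : ℝ) (y : E2) : kernelOp K Λ ψ (t, y) =
    kernelOp K Set.univ ({z : ℝ × E2 | (z.1, t) ∈ Λ}.indicator ψ) (t, y) := by
  unfold kernelOp
  congr 1 with z
  by_cases h : (z.1, t) ∈ Λ
  · simp [h]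
  · simp [h]

theorem lintegral_essSup_kernelOp_le (hK : IsDispersive K) (hΛ : MeasurableSet Λ)
    (hψ : Measurable ψ) :
    ∫⁻ τ, essSup (fun y => ‖kernelOp K Λ ψ (τ, y)‖ₑ) volume ^ 3 ≤
      (10368 * normL32L1 fun z => ‖ψ z‖ₑ) ^ 3 := by
  have := lintegral_essSup_cube_le_of_dual (measurable_kernelOp hK hΛ hψ).enorm
    (B := 5184 * normL32L1 fun z => ‖ψ z‖ₑ) (fun ρ hρ => by
      rw [mul_assoc]
      exact lintegral_enorm_kernelOp_mul_le hK hψ hρ)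
  refine this.trans_eq ?_
  rw [← mul_assoc]
  norm_num

theorem lintegral_kernelOp_sq_le_normL32L1 (hK : IsDispersive K) (hΛ : MeasurableSet Λ)
    (hψ : Measurable ψ) (hψi : Integrable ψ) (t : ℝ) :
    ∫⁻ y, ‖kernelOp K Λ ψ (t, y)‖ₑ ^ 2 ≤ (72 * normL32L1 fun z => ‖ψ z‖ₑ) ^ 2 := by
  have hs : MeasurableSet {z : ℝ × E2 | (z.1, t) ∈ Λ} :=
    (by fun_prop : Measurable fun z : ℝ × E2 => (z.1, t)) hΛ
  simp_rw [kernelOp_eq_univ (Λ := Λ) (ψ := ψ)]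
  set φ := {z : ℝ × E2 | (z.1, t) ∈ Λ}.indicator ψ with hφ
  have hφm : Measurable φ := hψ.indicator hs
  calc _ ≤ ∫⁻ z, ‖φ z‖ₑ * ‖kernelOp K Set.univ φ z‖ₑ :=
        lintegral_kernelOp_univ_sq_le hK hφm (hψi.indicator hs) t
    _ ≤ 5184 * (normL32L1 (fun z => ‖φ z‖ₑ) * normL32L1 fun z => ‖φ z‖ₑ) := by
        simp_rw [mul_comm ‖φ _‖ₑ]
        exact lintegral_enorm_kernelOp_mul_le hK hφm hφm.enorm
    _ ≤ 5184 * (normL32L1 (fun z => ‖ψ z‖ₑ) * normL32L1 fun z => ‖ψ z‖ₑ) := by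
        have : normL32L1 (fun z => ‖φ z‖ₑ) ≤ normL32L1 fun z => ‖ψ z‖ₑ :=
          normL32L1_mono fun z => enorm_indicator_le_enorm_self _ _
        gcongr
    _ = _ := by rw [mul_pow, sq (normL32L1 _)]; norm_num

theorem lintegral_kernelOp_sq_le_normL1L2 (hK : IsDispersive K) (hΛ : MeasurableSet Λ)
    (hψ : Measurable ψ) (hψi : Integrable ψ) (t : ℝ) :
    ∫⁻ y, ‖kernelOp K Λ ψ (t, y)‖ₑ ^ 2 ≤ (normL1L2 fun z => ‖ψ z‖ₑ) ^ 2 := by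
  have hs : MeasurableSet {z : ℝ × E2 | (z.1, t) ∈ Λ} :=
    (by fun_prop : Measurable fun z : ℝ × E2 => (z.1, t)) hΛ
  simp_rw [kernelOp_eq_univ (Λ := Λ) (ψ := ψ)]
  set φ := {z : ℝ × E2 | (z.1, t) ∈ Λ}.indicator ψ with hφ
  have hφm : Measurable φ := hψ.indicator hs
  have hφi : Integrable φ := hψi.indicator hs
  set I := ∫⁻ z, ‖φ z‖ₑ * ‖kernelOp K Set.univ φ z‖ₑ with hI
  have hsq : (I ^ (1/2 : ℝ)) ^ 2 = I := by
    rw [← ENNReal.rpow_natCast, ← ENNReal.rpow_mul]; norm_num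
  have hIfin : I ≠ ∞ := by
    obtain ⟨B, hB, hBK⟩ := hK.exists_enorm_le
    have hfin : ∫⁻ z, ‖φ z‖ₑ ≠ ∞ := hφi.2.ne
    refine ne_top_of_le_ne_top (b := (∫⁻ z, ‖φ z‖ₑ) * (B * ∫⁻ z, ‖φ z‖ₑ)) (by finiteness) ?_
    rw [← lintegral_mul_const _ hφm.enorm]
    refine lintegral_mono fun z => ?_
    dsimp only
    gcongr
    exact enorm_kernelOp_le_of_bounded hBK hφm z
  have key : I ≤ normL1L2 (fun z => ‖φ z‖ₑ) * I ^ (1/2 : ℝ) := by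
    refine lintegral_mul_le_normL1L2 hφm.enorm
      (measurable_kernelOp hK MeasurableSet.univ hφm).enorm fun τ => ?_
    rw [hsq]
    exact lintegral_kernelOp_univ_sq_le hK hφm hφi τ
  have key2 : I ^ (1/2 : ℝ) ≤ normL1L2 fun z => ‖ψ z‖ₑ := by
    refine le_trans ?_ (normL1L2_mono fun z => enorm_indicator_le_enorm_self _ z :
      normL1L2 (fun z => ‖φ z‖ₑ) ≤ _)
    by_cases h0 : I ^ (1/2 : ℝ) = 0
    · rw [h0]; exact zero_le
    · have htop : I ^ (1/2 : ℝ) ≠ ∞ := by finiteness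
      rw [← ENNReal.mul_le_mul_iff_left h0 htop, ← sq, hsq]
      exact key
  calc _ ≤ I := lintegral_kernelOp_univ_sq_le hK hφm hφi t
    _ = (I ^ (1/2 : ℝ)) ^ 2 := hsq.symm
    _ ≤ _ := by gcongr

theorem lintegral_essSup_kernelOp_le_normL1L2 (hK : IsDispersive K) (hΛ : MeasurableSet Λ)
    (hψ : Measurable ψ) (hψi : Integrable ψ) :
    ∫⁻ τ, essSup (fun y => ‖kernelOp K Λ ψ (τ, y)‖ₑ) volume ^ 3 ≤
      (144 * normL1L2 fun z => ‖ψ z‖ₑ) ^ 3 := by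
  have hOm := measurable_kernelOp hK hΛ hψ
  set Q : ℕ → Set (ℝ × E2) := fun n => Metric.closedBall 0 n with hQ
  have hQm : Monotone Q := fun m n hmn => Metric.closedBall_subset_closedBall (by exact_mod_cast hmn)
  have := lintegral_essSup_cube_le_of_dual hOm.enorm
    (B := 72 * normL1L2 fun z => ‖ψ z‖ₑ) (fun ρ hρ => by
      refine lintegral_mul_le_of_truncation normL32L1_mono hOm.enorm (Q := Q)
        (fun n => measurableSet_closedBall) hQm (fun z _ => ?_) (fun n σ hσ hσn hσ0 => ?_) hρ
      · obtain ⟨n, hn⟩ := exists_nat_ge ‖z‖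
        exact ⟨n, by simpa [hQ] using hn⟩
      · set Φ := dualPhase (kernelOp K Λ ψ) σ with hΦ
        have hΦm : Measurable Φ := measurable_dualPhase hOm hσ
        have hΦi : Integrable Φ := by
          refine integrable_of_enorm_le_natCast hΦm (n := n) (s := Q n) measure_closedBall_lt_top.ne
            (fun z => (enorm_dualPhase_le _ _ z).trans (hσn z)) fun z hz => ?_
          simp [hΦ, dualPhase, hσ0 z hz]
        have hi : Integrable fun z => kernelOp K Λ ψ z * Φ z := by
          obtain ⟨B, hB, hBK⟩ := hK.exists_enorm_le
          refine ⟨(hOm.mul hΦm).aestronglyMeasurable, ?_⟩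
          rw [hasFiniteIntegral_iff_enorm]
          have h1 : ∫⁻ z, ‖ψ z‖ₑ ≠ ∞ := hψi.2.ne
          have h2 : ∫⁻ z, ‖Φ z‖ₑ ≠ ∞ := hΦi.2.ne
          refine lt_of_le_of_lt (b := (B * ∫⁻ z, ‖ψ z‖ₑ) * ∫⁻ z, ‖Φ z‖ₑ) ?_ (by finiteness)
          rw [← lintegral_const_mul _ hΦm.enorm]
          refine lintegral_mono fun z => ?_
          rw [enorm_mul]
          gcongr
          exact enorm_kernelOp_le_of_bounded hBK hψ z
        rw [lintegral_enorm_mul_eq (fun z => ((hσn z).trans_lt (by finiteness)).ne) hi,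
          integral_kernelOp_mul hK hΛ hψ hψi hΦm hΦi]
        refine (enorm_integral_le_lintegral_enorm _).trans ?_
        simp_rw [enorm_mul]
        refine (lintegral_mul_le_normL1L2 hψ.enorm
          (measurable_kernelOp hK.conj (measurable_swap hΛ) hΦm).enorm
          (lintegral_kernelOp_sq_le_normL32L1 hK.conj (measurable_swap hΛ) hΦm hΦi)).trans ?_
        have h3 : normL32L1 (fun z => ‖Φ z‖ₑ) ≤ normL32L1 σ :=
          normL32L1_mono fun z => enorm_dualPhase_le _ σ z
        calc _ = 72 * (normL1L2 fun z => ‖ψ z‖ₑ) * normL32L1 fun z => ‖Φ z‖ₑ := by ring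
          _ ≤ _ := by gcongr)
  refine this.trans_eq ?_
  rw [← mul_assoc]
  norm_num

end kernelOp

/-- A family of functions depending continuously on a parameter is, up to a null set of the
variable and on the set of parameters where it is almost everywhere measurable, jointly
measurable. -/
theorem exists_measurable_indicator_uncurry {X α : Type*} [TopologicalSpace X]
    [TopologicalSpace.MetrizableSpace X] [SecondCountableTopology X] [MeasurableSpace X]
    [BorelSpace X] [MeasurableSpace α] (μ : Measure α) {g : X → α → ℂ}
    (hg : ∀ s, Continuous fun p => g p s) :
    ∃ (M : Set X) (N : Set α), MeasurableSet M ∧ MeasurableSet N ∧ μ N = 0 ∧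
      (∀ p, AEMeasurable (g p) μ → p ∈ M) ∧
      Measurable ((M ×ˢ Nᶜ).indicator (Function.uncurry g)) := by
  set M : Set X := {p | AEMeasurable (g p) μ} with hM
  have hMc : IsClosed M := by
    refine IsSeqClosed.isClosed fun p x hp hx => ?_
    exact aemeasurable_of_tendsto_metrizable_ae' hp
      (Filter.Eventually.of_forall fun s => ((hg s).tendsto x).comp hx)
  obtain ⟨S, hSc, hSd⟩ := TopologicalSpace.exists_countable_dense M
  have hae : ∀ᵐ s ∂μ, ∀ p ∈ S, g p s = (p.2 : AEMeasurable (g p) μ).mk (g p) s := by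
    rw [ae_ball_iff hSc]
    exact fun p _ => (p.2 : AEMeasurable (g p) μ).ae_eq_mk
  obtain ⟨N, hsub, hN, hN0⟩ := exists_measurable_superset_of_null (ae_iff.1 hae)
  refine ⟨M, N, hMc.measurableSet, hN, hN0, fun p hp => hp, ?_⟩
  have hS : ∀ p ∈ S, Measurable (Nᶜ.indicator (g p)) := fun p hp => by
    have : Nᶜ.indicator (g p) = Nᶜ.indicator ((p.2 : AEMeasurable (g p) μ).mk (g p)) := by
      refine Set.indicator_congr fun s hs => ?_
      by_contra h
      exact hs (hsub fun hall => h (hall p hp))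
    rw [this]
    exact (p.2 : AEMeasurable (g p) μ).measurable_mk.indicator hN.compl
  have hcont : ∀ s, Continuous fun p : M => Nᶜ.indicator (g p) s := fun s => by
    by_cases hs : s ∈ N
    · simpa [hs] using continuous_const
    · simpa [hs, Function.comp_def] using (hg s).comp continuous_subtype_val
  have hm : ∀ p : M, Measurable (Nᶜ.indicator (g p)) := fun p => by
    obtain ⟨d, hd, hdp⟩ := mem_closure_iff_seq_limit.1 (hSd p)
    refine measurable_of_tendsto_metrizable (fun k => hS (d k) (hd k))
      (tendsto_pi_nhds.2 fun s => ((hcont s).tendsto p).comp hdp)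
  have hunc := measurable_uncurry_of_continuous_of_measurable
    (u := fun (p : M) => Nᶜ.indicator (g p)) hcont hm
  have hemb : MeasurableEmbedding (Prod.map (Subtype.val : M → X) (id : α → α)) :=
    (MeasurableEmbedding.subtype_coe hMc.measurableSet).prodMap MeasurableEmbedding.id
  convert hemb.measurable_extend hunc (measurable_const (a := (0 : ℂ))) using 1
  ext ⟨p, s⟩
  by_cases hp : p ∈ M
  · have e : ((p, s) : X × α) = Prod.map (Subtype.val : M → X) (id : α → α) (⟨p, hp⟩, s) := rfl
    rw [e, hemb.injective.extend_apply]
    by_cases hs : s ∈ N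
    · simp [Function.uncurry, hs]
    · simp [Function.uncurry, hs, hp]
  · rw [Function.extend_apply']
    · simp [hp]
    · rintro ⟨⟨q, s'⟩, h⟩
      have : (q : X) = p := congrArg Prod.fst h
      exact hp (this ▸ q.2)

/-- The Duhamel integral `∫_τ^∞ V(τ-τ')F(τ')dτ'`. -/
def duhamel (F : ℝ → E2 → ℂ) (p : ℝ × E2) : ℂ :=
  ∫ τ' in Set.Ioi p.1, Vop (p.1 - τ') (F τ') p.2

theorem exists_measurable_duhamel_integrand (F : ℝ → E2 → ℂ) :
    ∃ (L : (ℝ × E2) × ℝ → ℂ) (M : Set (ℝ × E2)) (N : Set ℝ), Measurable L ∧ MeasurableSet M ∧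
      volume N = 0 ∧ (∀ p ∈ M, ∀ τ' ∉ N, L (p, τ') =
        (Set.Ioi p.1).indicator (fun τ' => Vop (p.1 - τ') (F τ') p.2) τ') ∧
      ∀ p ∉ M, duhamel F p = 0 := by
  set g : ℝ × E2 → ℝ → ℂ := fun p τ' => ((max (τ' - p.1) 0 : ℝ) : ℂ) * Vop (p.1 - τ') (F τ') p.2
    with hg
  have hgc : ∀ τ', Continuous fun p => g p τ' := fun τ' => by
    have h0 : Continuous fun p : ℝ × E2 => (p.1 - τ', p.2) := by fun_prop
    have h1 := (continuous_Vop (F τ')).comp h0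
    simp only [Function.comp_def] at h1
    have h2 : Continuous fun p : ℝ × E2 => ((max (τ' - p.1) 0 : ℝ) : ℂ) := by fun_prop
    exact h2.mul h1
  obtain ⟨M, N, hM, hN, hN0, hMg, hmeas⟩ := exists_measurable_indicator_uncurry volume hgc
  refine ⟨fun z => ((max (z.2 - z.1.1) 0 : ℝ) : ℂ)⁻¹ *
    (M ×ˢ Nᶜ).indicator (Function.uncurry g) z, M, N, ?_, hM, hN0, fun p hp τ' hτ' => ?_,
    fun p hp => ?_⟩
  · exact Measurable.mul (by fun_prop) hmeas
  · have : ((p, τ') : (ℝ × E2) × ℝ) ∈ M ×ˢ Nᶜ := ⟨hp, hτ'⟩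
    dsimp only
    rw [Set.indicator_of_mem this]
    by_cases h : p.1 < τ'
    · have h0 : 0 < τ' - p.1 := sub_pos.2 h
      have h1 : ((τ' - p.1 : ℝ) : ℂ) ≠ 0 := Complex.ofReal_ne_zero.2 h0.ne'
      rw [Set.indicator_of_mem (Set.mem_Ioi.2 h)]
      simp only [hg, Function.uncurry, max_eq_left h0.le]
      rw [inv_mul_cancel_left₀ h1]
    · rw [Set.indicator_of_notMem (by simpa using h)]
      simp [max_eq_right (sub_nonpos.2 (not_lt.1 h))]
  · by_contra hne
    refine hp (hMg p ?_)
    have hi : IntegrableOn (fun τ' => Vop (p.1 - τ') (F τ') p.2) (Set.Ioi p.1) := by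
      by_contra hni
      exact hne (integral_undef hni)
    have hi' := ((integrable_indicator_iff measurableSet_Ioi).2 hi).aemeasurable
    have : g p = fun τ' => ((max (τ' - p.1) 0 : ℝ) : ℂ) *
        (Set.Ioi p.1).indicator (fun τ' => Vop (p.1 - τ') (F τ') p.2) τ' := by
      ext τ'
      by_cases h : p.1 < τ'
      · rw [Set.indicator_of_mem (Set.mem_Ioi.2 h)]
      · rw [Set.indicator_of_notMem (by simpa using h)]
        simp [hg, max_eq_right (sub_nonpos.2 (not_lt.1 h))]
    rw [this]
    exact AEMeasurable.mul (by fun_prop) hi'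

/-- The Duhamel integral of an arbitrary function is measurable: it vanishes where the integrand is
not integrable, and elsewhere it is the integral of a jointly measurable function. -/
theorem exists_measurable_duhamel (F : ℝ → E2 → ℂ) :
    ∃ (L : (ℝ × E2) × ℝ → ℂ) (M : Set (ℝ × E2)) (N : Set ℝ), Measurable L ∧ MeasurableSet M ∧
      volume N = 0 ∧ (∀ p ∈ M, ∀ τ' ∉ N, L (p, τ') =
        (Set.Ioi p.1).indicator (fun τ' => Vop (p.1 - τ') (F τ') p.2) τ') ∧
      (∀ p ∈ M, ∫⁻ τ', ‖L (p, τ')‖ₑ < ∞) ∧ (∀ p ∈ M, duhamel F p = ∫ τ', L (p, τ')) ∧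
      (∀ p ∉ M, duhamel F p = 0) ∧ Measurable (duhamel F) := by
  obtain ⟨L, M, N, hL, hM, hN, hLM, hd⟩ := exists_measurable_duhamel_integrand F
  have hInt : Measurable fun p => ∫⁻ τ', ‖L (p, τ')‖ₑ := hL.enorm.lintegral_prod_right'
  have hM' : MeasurableSet (M ∩ {p | ∫⁻ τ', ‖L (p, τ')‖ₑ < ∞}) :=
    hM.inter (measurableSet_lt hInt measurable_const)
  have hae : ∀ p ∈ M, (fun τ' => L (p, τ')) =ᵐ[volume]
      (Set.Ioi p.1).indicator (fun τ' => Vop (p.1 - τ') (F τ') p.2) := fun p hp => by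
    have : ∀ᵐ τ', τ' ∉ N := measure_eq_zero_iff_ae_notMem.1 hN
    filter_upwards [this] with τ' h using hLM p hp τ' h
  have heq : ∀ p ∈ M, duhamel F p = ∫ τ', L (p, τ') := fun p hp => by
    rw [integral_congr_ae (hae p hp), integral_indicator measurableSet_Ioi, duhamel]
  have hzero : ∀ p ∉ M ∩ {p | ∫⁻ τ', ‖L (p, τ')‖ₑ < ∞}, duhamel F p = 0 := fun p hp => by
    by_cases h : p ∈ M
    · rw [heq p h]
      refine integral_undef fun hi => hp ⟨h, ?_⟩
      exact hi.2
    · exact hd p h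
  refine ⟨L, _, N, hL, hM', hN, fun p hp => hLM p hp.1, fun p hp => hp.2,
    fun p hp => heq p hp.1, hzero, ?_⟩
  have : duhamel F = (M ∩ {p | ∫⁻ τ', ‖L (p, τ')‖ₑ < ∞}).indicator fun p => ∫ τ', L (p, τ') := by
    ext p
    by_cases h : p ∈ M ∩ {p | ∫⁻ τ', ‖L (p, τ')‖ₑ < ∞}
    · rw [Set.indicator_of_mem h, heq p h.1]
    · rw [Set.indicator_of_notMem h, hzero p h]
  rw [this]
  exact (hL.stronglyMeasurable.integral_prod_right (f := fun p τ' => L (p, τ'))).measurable.indicator hM'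

theorem admissible_cases {q r : ℝ≥0∞} (hadm : 3 / q + 2 / r = 1) :
    (q = ∞ ∧ r = 2) ∨
      (q ≠ 0 ∧ q ≠ ∞ ∧ 0 < q.toReal ∧ 3 / q.toReal = 1 - 2 * (r⁻¹).toReal) := by
  have hq0 : q ≠ 0 := by
    rintro rfl
    simp [ENNReal.div_zero] at hadm
  have hr0 : r ≠ 0 := by
    rintro rfl
    simp [ENNReal.div_zero] at hadm
  have hreal : 3 * (q⁻¹).toReal + 2 * (r⁻¹).toReal = 1 := by
    have := congrArg ENNReal.toReal hadm
    rw [ENNReal.toReal_add (by finiteness) (by finiteness), ENNReal.toReal_div,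
      ENNReal.toReal_div] at this
    simpa [div_eq_mul_inv, ENNReal.toReal_inv] using this
  by_cases hq : q = ∞
  · left
    refine ⟨hq, ?_⟩
    rw [hq] at hadm
    simp only [ENNReal.div_top, zero_add] at hadm
    exact ((ENNReal.div_eq_one_iff hr0 (by
      rintro rfl
      simp at hadm)).1 hadm).symm
  · right
    refine ⟨hq0, hq, ENNReal.toReal_pos hq0 hq, ?_⟩
    rw [ENNReal.toReal_inv] at hreal
    rw [div_eq_mul_inv]
    linarith

theorem eLpNorm_le_rpow_mul_rpow {r : ℝ≥0∞} (hr : 2 ≤ r) {W : E2 → ℂ} (hW : Measurable W) :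
    eLpNorm W r volume ≤ (∫⁻ x, ‖W x‖ₑ ^ 2) ^ (r⁻¹).toReal *
      essSup (fun x => ‖W x‖ₑ) volume ^ (1 - 2 * (r⁻¹).toReal) := by
  by_cases hr' : r = ∞
  · simp [hr', eLpNorm_exponent_top, eLpNormEssSup]
  have hr0 : r ≠ 0 := by
    rintro rfl
    simp at hr
  have h2 : 2 ≤ r.toReal := by
    have := ENNReal.toReal_mono hr' hr
    simpa using this
  have hpos : 0 < r.toReal := by linarith
  set S := essSup (fun x => ‖W x‖ₑ) volume with hS
  rw [eLpNorm_eq_lintegral_rpow_enorm_toReal hr0 hr', ENNReal.toReal_inv]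
  have h1 : ∫⁻ x, ‖W x‖ₑ ^ r.toReal ≤ (∫⁻ x, ‖W x‖ₑ ^ 2) * S ^ (r.toReal - 2) := by
    rw [← lintegral_mul_const _ (hW.enorm.pow_const 2)]
    refine lintegral_mono_ae ?_
    filter_upwards [_root_.ae_le_essSup (f := fun x => ‖W x‖ₑ) (μ := volume)] with x hx
    calc ‖W x‖ₑ ^ r.toReal = ‖W x‖ₑ ^ 2 * ‖W x‖ₑ ^ (r.toReal - 2) := by
          rw [← ENNReal.rpow_two, ← ENNReal.rpow_add_of_nonneg _ _ (by norm_num) (by linarith)]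
          congr 1
          ring
      _ ≤ _ := by
          have : 0 ≤ r.toReal - 2 := by linarith
          gcongr
  calc _ ≤ ((∫⁻ x, ‖W x‖ₑ ^ 2) * S ^ (r.toReal - 2)) ^ (1 / r.toReal) := by gcongr
    _ = _ := by
        rw [ENNReal.mul_rpow_of_nonneg _ _ (by positivity), ← ENNReal.rpow_mul, one_div]
        congr 2
        field_simp

/-- Interpolation between the endpoints `(∞, 2)` and `(3, ∞)`. -/
theorem exists_eLpNorm_section_le {q r : ℝ≥0∞} (hadm : 3 / q + 2 / r = 1) (hr : 2 ≤ r)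
    {W : ℝ × E2 → ℂ} (hW : Measurable W) {B : ℝ≥0∞}
    (h2 : ∀ᵐ τ : ℝ, ∫⁻ x, ‖W (τ, x)‖ₑ ^ 2 ≤ B ^ 2)
    (h3 : ∫⁻ τ, essSup (fun x => ‖W (τ, x)‖ₑ) volume ^ 3 ≤ B ^ 3) :
    ∃ g : ℝ → ℝ≥0∞, Measurable g ∧ (∀ᵐ τ, eLpNorm (fun x => W (τ, x)) r volume ≤ g τ) ∧
      eLpNorm g q volume ≤ B := by
  have hint : ∀ τ, eLpNorm (fun x => W (τ, x)) r volume ≤ _ := fun τ =>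
    eLpNorm_le_rpow_mul_rpow hr (W := fun x => W (τ, x)) (hW.comp measurable_prodMk_left)
  have hsq : ∀ s : ℝ, (B ^ 2) ^ s = B ^ (2 * s) := fun s => by
    rw [← ENNReal.rpow_two, ← ENNReal.rpow_mul]
  rcases admissible_cases hadm with ⟨rfl, rfl⟩ | ⟨hq0, hq, hqp, hqr⟩
  · refine ⟨fun _ => B, measurable_const, ?_, ?_⟩
    · filter_upwards [h2] with τ hτ
      refine (hint τ).trans ?_
      have e1 : ((2 : ℝ≥0∞)⁻¹).toReal = 1 / 2 := by simp
      rw [e1, show (1 : ℝ) - 2 * (1 / 2) = 0 by norm_num, ENNReal.rpow_zero, mul_one]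
      calc _ ≤ (B ^ 2) ^ (1 / 2 : ℝ) := by gcongr
        _ = B := by rw [hsq, show (2 : ℝ) * (1 / 2) = 1 by norm_num, ENNReal.rpow_one]
    · rw [eLpNorm_exponent_top]
      exact eLpNormEssSup_le_of_ae_enorm_bound (Filter.Eventually.of_forall fun _ => le_rfl)
  · set S : ℝ → ℝ≥0∞ := fun τ => essSup (fun x => ‖W (τ, x)‖ₑ) volume with hS
    have hSm : Measurable S := measurable_essSup_section (a := fun z => ‖W z‖ₑ) hW.enorm
    have hrnn : 0 ≤ (r⁻¹).toReal := ENNReal.toReal_nonneg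
    refine ⟨fun τ => B ^ (2 * (r⁻¹).toReal) * S τ ^ (1 - 2 * (r⁻¹).toReal),
      measurable_const.mul (hSm.pow_const _), ?_, ?_⟩
    · filter_upwards [h2] with τ hτ
      refine (hint τ).trans ?_
      rw [← hsq]
      gcongr
    · rw [← hqr, eLpNorm_eq_lintegral_rpow_enorm_toReal hq0 hq]
      simp only [enorm_eq_self]
      have e : ∀ τ, (B ^ (2 * (r⁻¹).toReal) * S τ ^ (3 / q.toReal)) ^ q.toReal =
          B ^ (2 * (r⁻¹).toReal * q.toReal) * S τ ^ 3 := fun τ => by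
        rw [ENNReal.mul_rpow_of_nonneg _ _ hqp.le, ← ENNReal.rpow_mul, ← ENNReal.rpow_mul,
          div_mul_cancel₀ _ hqp.ne', ← ENNReal.rpow_natCast (S τ)]
        norm_num
      simp_rw [e]
      rw [lintegral_const_mul _ (hSm.pow_const 3)]
      calc _ ≤ (B ^ (2 * (r⁻¹).toReal * q.toReal) * B ^ 3) ^ (1 / q.toReal) := by gcongr
        _ = B := by
          rw [← ENNReal.rpow_natCast B, ← ENNReal.rpow_add_of_nonneg _ _ (by positivity)
            (by norm_num), ← ENNReal.rpow_mul]
          convert ENNReal.rpow_one B using 2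
          have : 2 * (r⁻¹).toReal = 1 - 3 / q.toReal := by linarith
          rw [this]
          push_cast
          field_simp
          ring

/-- Fatou's lemma for `L^q` norms. -/
theorem eLpNorm_liminf_le {q B : ℝ≥0∞} (hq0 : q ≠ 0) {g : ℕ → ℝ → ℝ≥0∞}
    (hg : ∀ n, Measurable (g n)) (h : ∀ n, eLpNorm (g n) q volume ≤ B) :
    eLpNorm (fun τ => Filter.liminf (fun n => g n τ) Filter.atTop) q volume ≤ B := by
  by_cases hq : q = ∞
  · subst hq
    rw [eLpNorm_exponent_top]
    refine eLpNormEssSup_le_of_ae_enorm_bound ?_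
    have : ∀ᵐ τ, ∀ n, g n τ ≤ B := ae_all_iff.2 fun n => by
      have h1 := h n
      rw [eLpNorm_exponent_top] at h1
      filter_upwards [enorm_ae_le_eLpNormEssSup (g n) volume] with τ hτ
      exact hτ.trans h1
    filter_upwards [this] with τ hτ
    exact Filter.liminf_le_of_frequently_le' (Filter.Frequently.of_forall hτ)
  · have hqp := ENNReal.toReal_pos hq0 hq
    simp only [eLpNorm_eq_lintegral_rpow_enorm_toReal hq0 hq, enorm_eq_self] at h ⊢
    have h' : ∀ n, ∫⁻ τ, g n τ ^ q.toReal ≤ B ^ q.toReal := fun n => by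
      rw [← ENNReal.rpow_le_rpow_iff (z := 1 / q.toReal) (by positivity), ← ENNReal.rpow_mul B,
        mul_one_div_cancel hqp.ne', ENNReal.rpow_one]
      exact h n
    have e : ∀ τ, Filter.liminf (fun n => g n τ) Filter.atTop ^ q.toReal =
        Filter.liminf (fun n => g n τ ^ q.toReal) Filter.atTop := fun τ =>
      (ENNReal.orderIsoRpow q.toReal hqp).liminf_apply
    simp_rw [e]
    calc _ ≤ (B ^ q.toReal) ^ (1 / q.toReal) := by
          gcongr
          refine (lintegral_liminf_le fun n => (hg n).pow_const _).trans ?_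
          exact Filter.liminf_le_of_frequently_le' (Filter.Frequently.of_forall h')
      _ = B := by rw [← ENNReal.rpow_mul, mul_one_div_cancel hqp.ne', ENNReal.rpow_one]

/-- Hölder's inequality with a factor `a` which need not be measurable. -/
theorem lintegral_le_mul_of_le_mul {α : Type*} [MeasurableSpace α] {μ : Measure α}
    {q q' : ℝ≥0∞} (hq : 1 ≤ q') (hq' : q' ≠ ∞) (hqq : q⁻¹ + q'⁻¹ = 1)
    {h a g : α → ℝ≥0∞} (hh : Measurable h) (hg : Measurable g)
    (hle : ∀ᵐ x ∂μ, a x ≠ ∞ → h x ≤ a x * g x) {X B : ℝ≥0∞} (hX : X ≠ ∞) (hB : B ≠ ∞)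
    (ha : (∫⁻ x, a x ^ q'.toReal ∂μ) ^ (1 / q'.toReal) ≤ X) (hgB : eLpNorm g q μ ≤ B) :
    ∫⁻ x, h x ∂μ ≤ X * B := by
  have hq'0 : q' ≠ 0 := by
    rintro rfl
    simp at hq
  have hq'p : 0 < q'.toReal := ENNReal.toReal_pos hq'0 hq'
  set b : α → ℝ≥0∞ := fun x => h x / g x with hb
  have hbm : Measurable b := hh.div hg
  have hba : ∀ᵐ x ∂μ, b x ≤ a x := by
    filter_upwards [hle] with x hx
    by_cases hax : a x = ∞
    · rw [hax]; exact le_top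
    · exact ENNReal.div_le_of_le_mul (hx hax)
  have hbX : eLpNorm b q' μ ≤ X := by
    rw [eLpNorm_eq_lintegral_rpow_enorm_toReal hq'0 hq']
    refine le_trans ?_ ha
    gcongr ?_ ^ _
    refine lintegral_mono_ae ?_
    filter_upwards [hba] with x hx
    rw [enorm_eq_self]
    gcongr
  have hbfin : ∀ᵐ x ∂μ, b x < ∞ := by
    have : ∫⁻ x, b x ^ q'.toReal ∂μ ≠ ∞ := by
      intro htop
      rw [eLpNorm_eq_lintegral_rpow_enorm_toReal hq'0 hq'] at hbX
      simp only [enorm_eq_self, htop] at hbX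
      rw [ENNReal.top_rpow_of_pos (by positivity)] at hbX
      exact hX (top_le_iff.1 hbX)
    filter_upwards [ae_lt_top (hbm.pow_const _) this] with x hx
    by_contra hxt
    rw [not_lt_top_iff.1 hxt, ENNReal.top_rpow_of_pos hq'p] at hx
    exact lt_irrefl _ hx
  have hgfin : ∀ᵐ x ∂μ, g x < ∞ := by
    by_cases hqt : q = ∞
    · subst hqt
      rw [eLpNorm_exponent_top] at hgB
      filter_upwards [enorm_ae_le_eLpNormEssSup g μ] with x hx
      exact (hx.trans hgB).trans_lt hB.lt_top
    · have hq0 : q ≠ 0 := by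
        rintro rfl
        simp at hqq
      have hqp := ENNReal.toReal_pos hq0 hqt
      have : ∫⁻ x, g x ^ q.toReal ∂μ ≠ ∞ := by
        intro htop
        rw [eLpNorm_eq_lintegral_rpow_enorm_toReal hq0 hqt] at hgB
        simp only [enorm_eq_self, htop] at hgB
        rw [ENNReal.top_rpow_of_pos (by positivity)] at hgB
        exact hB (top_le_iff.1 hgB)
      filter_upwards [ae_lt_top (hg.pow_const _) this] with x hx
      by_contra hxt
      rw [not_lt_top_iff.1 hxt, ENNReal.top_rpow_of_pos hqp] at hx
      exact lt_irrefl _ hx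
  have heq : ∀ᵐ x ∂μ, h x = b x * g x := by
    filter_upwards [hbfin, hgfin] with x hbx hgx
    by_cases hg0 : g x = 0
    · have : h x = 0 := by
        by_contra hh0
        simp [hb, hg0, ENNReal.div_zero hh0] at hbx
      rw [this, hg0, mul_zero]
    · exact (ENNReal.div_mul_cancel hg0 hgx.ne).symm
  rw [lintegral_congr_ae heq]
  refine le_trans ?_ (mul_le_mul' hbX hgB)
  by_cases hqt : q = ∞
  · subst hqt
    have : q' = 1 := by simpa using hqq
    subst this
    rw [eLpNorm_exponent_top, eLpNorm_one_eq_lintegral_enorm]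
    simp only [enorm_eq_self]
    rw [← lintegral_mul_const _ hbm]
    refine lintegral_mono_ae ?_
    filter_upwards [enorm_ae_le_eLpNormEssSup g μ] with x hx
    gcongr
    exact hx
  · have hq0 : q ≠ 0 := by
      rintro rfl
      simp at hqq
    have hqp := ENNReal.toReal_pos hq0 hqt
    rw [eLpNorm_eq_lintegral_rpow_enorm_toReal hq0 hqt,
      eLpNorm_eq_lintegral_rpow_enorm_toReal hq'0 hq']
    simp only [enorm_eq_self]
    refine ENNReal.lintegral_mul_le_Lp_mul_Lq μ ?_ hbm.aemeasurable hg.aemeasurable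
    have hreal : (q.toReal)⁻¹ + (q'.toReal)⁻¹ = 1 := by
      have := congrArg ENNReal.toReal hqq
      rwa [ENNReal.toReal_add (by finiteness) (by finiteness), ENNReal.toReal_inv,
        ENNReal.toReal_inv] at this
    rw [Real.holderConjugate_iff]
    refine ⟨?_, by linarith⟩
    have : 0 < (q.toReal)⁻¹ := by positivity
    exact (inv_lt_one₀ hq'p).1 (by linarith)

open scoped ComplexConjugate in
theorem integrable_mul_kernelOp_integrand {K : ℝ × E2 → ℂ} (hK : IsDispersive K)
    {Λ : Set (ℝ × ℝ)} (hΛ : MeasurableSet Λ) {ψ : ℝ × E2 → ℂ} (hψ : Measurable ψ)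
    (hψi : Integrable ψ) {f : E2 → ℂ} (hf : Integrable f) (s : ℝ) :
    Integrable (fun p : (ℝ × E2) × E2 =>
      f p.2 * (Λ.indicator (fun _ => (1 : ℂ)) (p.1.1, s) * K ((s, p.2) - p.1) * ψ p.1))
      ((volume : Measure (ℝ × E2)).prod volume) := by
  obtain ⟨B, hB⟩ := hK.bounded
  have hm := (measurable_kernelOp_integrand hK hΛ hψ).comp
    (by fun_prop : Measurable fun p : (ℝ × E2) × E2 => (((s, p.2), p.1) : (ℝ × E2) × (ℝ × E2)))
  refine ((hψi.norm.mul_prod hf.norm).const_mul B).mono'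
    (hf.aestronglyMeasurable.comp_snd.mul hm.aestronglyMeasurable)
    (Filter.Eventually.of_forall fun p => ?_)
  rw [norm_mul, norm_mul, norm_mul]
  have h1 : ‖Λ.indicator (fun _ => (1 : ℂ)) (p.1.1, s)‖ ≤ 1 := by
    by_cases h : (p.1.1, s) ∈ Λ
    · simp [h]
    · simp [h]
  have h3 : ‖Λ.indicator (fun _ => (1 : ℂ)) (p.1.1, s)‖ * ‖K ((s, p.2) - p.1)‖ ≤ B :=
    (mul_le_of_le_one_left (norm_nonneg _) h1).trans (hB _)
  calc _ ≤ ‖f p.2‖ * (B * ‖ψ p.1‖) := by gcongr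
    _ = _ := by ring

open scoped ComplexConjugate in
theorem tendsto_integral_mul_kernelOp {Λ : Set (ℝ × ℝ)} (hΛ : MeasurableSet Λ) {ψ : ℝ × E2 → ℂ}
    (hψ : Measurable ψ) (hψi : Integrable ψ) {f : E2 → ℂ} (hf : Integrable f)
    (hf' : Integrable (𝓕 f)) (s : ℝ) :
    Filter.Tendsto
      (fun m : ℕ => ∫ y, f y * kernelOp (fun z => conj (cutKernel m z)) Λ ψ (s, y)) Filter.atTop
      (nhds (∫ z : ℝ × E2,
        ψ z * (Λ.indicator (fun _ => (1 : ℂ)) (z.1, s) * Vop (z.1 - s) f z.2))) := by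
  have hK : ∀ m : ℕ, IsDispersive (cutKernel m) := fun m => isDispersive_cutKernel m.cast_nonneg
  have hint := fun m : ℕ => integrable_mul_kernelOp_integrand (hK m).conj hΛ hψ hψi hf s
  have hinner : ∀ (m : ℕ) (z : ℝ × E2), ∫ y, f y * (Λ.indicator (fun _ => (1 : ℂ)) (z.1, s) *
      conj (cutKernel m ((s, y) - z)) * ψ z) = ψ z * (Λ.indicator (fun _ => (1 : ℂ)) (z.1, s) *
        ∫ y, f y * cutKernel m (z.1 - s, z.2 - y)) := fun m z => by
    rw [← integral_const_mul, ← integral_const_mul]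
    congr 1 with y
    rw [← (hK m).conj_symm, neg_sub]
    have : z - (s, y) = (z.1 - s, z.2 - y) := rfl
    rw [this]
    ring
  have hsw : ∀ m : ℕ, ∫ y, f y * kernelOp (fun z => conj (cutKernel m z)) Λ ψ (s, y) =
      ∫ z : ℝ × E2, ψ z * (Λ.indicator (fun _ => (1 : ℂ)) (z.1, s) *
        ∫ y, f y * cutKernel m (z.1 - s, z.2 - y)) := fun m => by
    simp_rw [← hinner, kernelOp, ← integral_const_mul]
    exact (integral_integral_swap (hint m)).symm
  simp_rw [hsw]
  refine tendsto_integral_of_dominated_convergence (fun z => ‖ψ z‖ * ∫ ξ, ‖𝓕 f ξ‖)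
    (fun m => ?_) (hψi.norm.mul_const _) (fun m => Filter.Eventually.of_forall fun z => ?_)
    (Filter.Eventually.of_forall fun z => ?_)
  · have := (hint m).aestronglyMeasurable.integral_prod_right'
    simpa only [hinner] using this
  · rw [norm_mul, norm_mul]
    gcongr
    refine (mul_le_of_le_one_left (norm_nonneg _) ?_).trans
      (norm_integral_mul_cutKernel_le hf hf' m _ _)
    by_cases h : (z.1, s) ∈ Λ
    · simp [h]
    · simp [h]
  · exact ((tendsto_integral_mul_cutKernel hf hf' _ _).const_mul _).const_mul _

open scoped ComplexConjugate in
theorem enorm_integral_mul_Vop_le {r r' : ℝ≥0∞} (hr : r⁻¹ + r'⁻¹ = 1) {Λ : Set (ℝ × ℝ)}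
    (hΛ : MeasurableSet Λ) {ψ : ℝ × E2 → ℂ} (hψ : Measurable ψ) (hψi : Integrable ψ)
    (f : E2 → ℂ) (s : ℝ) (hfin : eLpNorm f r' volume ≠ ∞) :
    ‖∫ z : ℝ × E2, ψ z * (Λ.indicator (fun _ => (1 : ℂ)) (z.1, s) * Vop (z.1 - s) f z.2)‖ₑ ≤
      eLpNorm f r' volume * Filter.liminf (fun m : ℕ =>
        eLpNorm (fun y => kernelOp (fun z => conj (cutKernel m z)) Λ ψ (s, y)) r volume)
        Filter.atTop := by
  by_cases h : Integrable f ∧ Integrable (𝓕 f)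
  · have ht := (tendsto_integral_mul_kernelOp hΛ hψ hψi h.1 h.2 s).enorm
    rw [← ENNReal.liminf_const_mul_of_ne_top hfin, ← ht.liminf_eq]
    refine Filter.liminf_le_liminf (Filter.Eventually.of_forall fun m => ?_)
    have hW : Measurable fun y => kernelOp (fun z => conj (cutKernel m z)) Λ ψ (s, y) :=
      (measurable_kernelOp (isDispersive_cutKernel m.cast_nonneg).conj hΛ hψ).comp
        measurable_prodMk_left
    have hT : ENNReal.HolderTriple r' r 1 := ⟨by rw [add_comm, hr, inv_one]⟩
    have := eLpNorm_smul_le_mul_eLpNorm (p := r') (q := r) (r := 1) (μ := volume)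
      hW.aestronglyMeasurable h.1.aestronglyMeasurable
    refine le_trans ?_ this
    rw [eLpNorm_one_eq_lintegral_enorm]
    exact enorm_integral_le_lintegral_enorm _
  · simp [Vop_eq_zero h]

theorem normL32L1_ne_top {ρ : ℝ × E2 → ℝ≥0∞} {n : ℕ} (h : ∀ z, ρ z ≤ n)
    (h0 : ∀ z, z ∉ Metric.closedBall (0 : ℝ × E2) n → ρ z = 0) : normL32L1 ρ ≠ ∞ := by
  set c : ℝ≥0∞ := n * volume (Metric.closedBall (0 : E2) n) with hc
  have hcf : c ≠ ∞ := ENNReal.mul_ne_top (by finiteness) measure_closedBall_lt_top.ne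
  have hx : ∀ τ, ∫⁻ x, ρ (τ, x) ≤ (Metric.closedBall (0 : ℝ) n).indicator (fun _ => c) τ := by
    intro τ
    by_cases hτ : τ ∈ Metric.closedBall (0 : ℝ) n
    · rw [Set.indicator_of_mem hτ]
      calc ∫⁻ x, ρ (τ, x) ≤ ∫⁻ x, (Metric.closedBall (0 : E2) n).indicator
            (fun _ => (n : ℝ≥0∞)) x := by
            refine lintegral_mono fun x => ?_
            by_cases hx : x ∈ Metric.closedBall (0 : E2) n
            · rw [Set.indicator_of_mem hx]; exact h _
            · rw [h0 (τ, x) fun hz => hx ?_]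
              · exact zero_le
              · simp only [mem_closedBall_zero_iff] at hz ⊢
                exact (norm_snd_le (τ, x)).trans hz
        _ ≤ c := lintegral_indicator_const_le _ _
    · have : ∀ x, ρ (τ, x) = 0 := fun x => h0 _ fun hz => hτ (by
        simp only [mem_closedBall_zero_iff] at hz ⊢
        exact (norm_fst_le (τ, x)).trans hz)
      simp [this]
  refine ENNReal.rpow_ne_top_of_nonneg (by norm_num) (ne_top_of_le_ne_top
    (b := c ^ (3/2 : ℝ) * volume (Metric.closedBall (0 : ℝ) n)) ?_ ?_)
  · exact ENNReal.mul_ne_top (by finiteness) measure_closedBall_lt_top.ne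
  · calc ∫⁻ τ, (∫⁻ x, ρ (τ, x)) ^ (3/2 : ℝ) ≤
          ∫⁻ τ, (Metric.closedBall (0 : ℝ) n).indicator (fun _ => c ^ (3/2 : ℝ)) τ := by
          refine lintegral_mono fun τ => ?_
          have := hx τ
          by_cases hτ : τ ∈ Metric.closedBall (0 : ℝ) n
          · rw [Set.indicator_of_mem hτ] at this ⊢
            gcongr
          · rw [Set.indicator_of_notMem hτ] at this ⊢
            rw [le_zero_iff.1 this, ENNReal.zero_rpow_of_pos (by norm_num)]
      _ ≤ _ := lintegral_indicator_const_le _ _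

theorem normL1L2_ne_top {ρ : ℝ × E2 → ℝ≥0∞} {n : ℕ} (h : ∀ z, ρ z ≤ n)
    (h0 : ∀ z, z ∉ Metric.closedBall (0 : ℝ × E2) n → ρ z = 0) : normL1L2 ρ ≠ ∞ := by
  set c : ℝ≥0∞ := (n : ℝ≥0∞) ^ 2 * volume (Metric.closedBall (0 : E2) n) with hc
  have hcf : c ≠ ∞ := ENNReal.mul_ne_top (by finiteness) measure_closedBall_lt_top.ne
  have hx : ∀ τ, ∫⁻ x, ρ (τ, x) ^ 2 ≤ (Metric.closedBall (0 : ℝ) n).indicator (fun _ => c) τ := by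
    intro τ
    by_cases hτ : τ ∈ Metric.closedBall (0 : ℝ) n
    · rw [Set.indicator_of_mem hτ]
      calc ∫⁻ x, ρ (τ, x) ^ 2 ≤ ∫⁻ x, (Metric.closedBall (0 : E2) n).indicator
            (fun _ => (n : ℝ≥0∞) ^ 2) x := by
            refine lintegral_mono fun x => ?_
            by_cases hx : x ∈ Metric.closedBall (0 : E2) n
            · rw [Set.indicator_of_mem hx]
              dsimp only
              gcongr
              exact h _
            · rw [h0 (τ, x) fun hz => hx ?_]
              · simp
              · simp only [mem_closedBall_zero_iff] at hz ⊢
                exact (norm_snd_le (τ, x)).trans hz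
        _ ≤ c := lintegral_indicator_const_le _ _
    · have : ∀ x, ρ (τ, x) = 0 := fun x => h0 _ fun hz => hτ (by
        simp only [mem_closedBall_zero_iff] at hz ⊢
        exact (norm_fst_le (τ, x)).trans hz)
      simp [this]
  refine ne_top_of_le_ne_top
    (b := c ^ (1/2 : ℝ) * volume (Metric.closedBall (0 : ℝ) n)) ?_ ?_
  · exact ENNReal.mul_ne_top (by finiteness) measure_closedBall_lt_top.ne
  · calc ∫⁻ τ, (∫⁻ x, ρ (τ, x) ^ 2) ^ (1/2 : ℝ) ≤
          ∫⁻ τ, (Metric.closedBall (0 : ℝ) n).indicator (fun _ => c ^ (1/2 : ℝ)) τ := by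
          refine lintegral_mono fun τ => ?_
          have := hx τ
          by_cases hτ : τ ∈ Metric.closedBall (0 : ℝ) n
          · rw [Set.indicator_of_mem hτ] at this ⊢
            gcongr
          · rw [Set.indicator_of_notMem hτ] at this ⊢
            rw [le_zero_iff.1 this, ENNReal.zero_rpow_of_pos (by norm_num)]
      _ ≤ _ := lintegral_indicator_const_le _ _

/-- A space-time norm whose dual endpoint Strichartz estimates hold uniformly for all truncated
dispersive convolution operators. -/
structure IsStrichartzNorm (N : (ℝ × E2 → ℝ≥0∞) → ℝ≥0∞) : Prop where
  mono : Monotone N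
  ne_top : ∀ (n : ℕ) (ρ : ℝ × E2 → ℝ≥0∞), (∀ z, ρ z ≤ n) →
    (∀ z, z ∉ Metric.closedBall (0 : ℝ × E2) n → ρ z = 0) → N ρ ≠ ∞
  sq_le : ∀ (K : ℝ × E2 → ℂ) (Λ : Set (ℝ × ℝ)) (ψ : ℝ × E2 → ℂ), IsDispersive K →
    MeasurableSet Λ → Measurable ψ → Integrable ψ → ∀ t : ℝ,
      ∫⁻ y, ‖kernelOp K Λ ψ (t, y)‖ₑ ^ 2 ≤ (10368 * N fun z => ‖ψ z‖ₑ) ^ 2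
  essSup_cube_le : ∀ (K : ℝ × E2 → ℂ) (Λ : Set (ℝ × ℝ)) (ψ : ℝ × E2 → ℂ), IsDispersive K →
    MeasurableSet Λ → Measurable ψ → Integrable ψ →
      ∫⁻ τ, essSup (fun y => ‖kernelOp K Λ ψ (τ, y)‖ₑ) volume ^ 3 ≤
        (10368 * N fun z => ‖ψ z‖ₑ) ^ 3

theorem isStrichartzNorm_normL32L1 : IsStrichartzNorm normL32L1 where
  mono := normL32L1_mono
  ne_top _ _ := normL32L1_ne_top
  sq_le _ _ _ hK hΛ hψ hψi t := (lintegral_kernelOp_sq_le_normL32L1 hK hΛ hψ hψi t).trans (by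
    gcongr; norm_num)
  essSup_cube_le _ _ _ hK hΛ hψ _ := lintegral_essSup_kernelOp_le hK hΛ hψ

theorem isStrichartzNorm_normL1L2 : IsStrichartzNorm normL1L2 where
  mono := normL1L2_mono
  ne_top _ _ := normL1L2_ne_top
  sq_le _ _ _ hK hΛ hψ hψi t := (lintegral_kernelOp_sq_le_normL1L2 hK hΛ hψ hψi t).trans (by
    gcongr
    exact le_mul_of_one_le_left' (by norm_num))
  essSup_cube_le _ _ _ hK hΛ hψ hψi :=
    (lintegral_essSup_kernelOp_le_normL1L2 hK hΛ hψ hψi).trans (by gcongr; norm_num)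

open scoped ComplexConjugate in
/-- The liminf of the spatial norms of the truncated operators is controlled in time. -/
theorem IsStrichartzNorm.exists_liminf_le {N : (ℝ × E2 → ℝ≥0∞) → ℝ≥0∞} (hN : IsStrichartzNorm N)
    {q r : ℝ≥0∞} (hadm : 3 / q + 2 / r = 1) (hr : 2 ≤ r) {Λ : Set (ℝ × ℝ)}
    (hΛ : MeasurableSet Λ) {ψ : ℝ × E2 → ℂ} (hψ : Measurable ψ) (hψi : Integrable ψ) :
    ∃ g : ℝ → ℝ≥0∞, Measurable g ∧ (∀ᵐ s, Filter.liminf (fun m : ℕ =>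
        eLpNorm (fun y => kernelOp (fun z => conj (cutKernel m z)) Λ ψ (s, y)) r volume)
        Filter.atTop ≤ g s) ∧ eLpNorm g q volume ≤ 10368 * N fun z => ‖ψ z‖ₑ := by
  have hK : ∀ m : ℕ, IsDispersive fun z => conj (cutKernel m z) := fun m =>
    (isDispersive_cutKernel m.cast_nonneg).conj
  choose g hgm hge hgn using fun m : ℕ => exists_eLpNorm_section_le hadm hr
    (measurable_kernelOp (hK m) hΛ hψ)
    (Filter.Eventually.of_forall (hN.sq_le _ Λ ψ (hK m) hΛ hψ hψi))
    (hN.essSup_cube_le _ Λ ψ (hK m) hΛ hψ hψi)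
  have hq0 : q ≠ 0 := by
    rcases admissible_cases hadm with h | h
    · rw [h.1]; exact ENNReal.top_ne_zero
    · exact h.1
  refine ⟨fun s => Filter.liminf (fun m => g m s) Filter.atTop, Measurable.liminf hgm, ?_,
    eLpNorm_liminf_le hq0 hgm hgn⟩
  filter_upwards [ae_all_iff.2 hge] with s hs
  exact Filter.liminf_le_liminf (Filter.Eventually.of_forall hs)

theorem lintegral_enorm_duhamel_mul_le {N : (ℝ × E2 → ℝ≥0∞) → ℝ≥0∞} (hN : IsStrichartzNorm N)
    {q r q' r' : ℝ≥0∞} (hadm : 3 / q + 2 / r = 1) (hr : 2 ≤ r) (hqq : q⁻¹ + q'⁻¹ = 1)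
    (hrr : r⁻¹ + r'⁻¹ = 1) {t : ℝ} {F : ℝ → E2 → ℂ} (hX : mixedNorm q' r' t F ≠ ∞)
    {ρ : ℝ × E2 → ℝ≥0∞} (hρ : Measurable ρ) :
    ∫⁻ z, {z : ℝ × E2 | t < z.1}.indicator (fun z => ‖duhamel F z‖ₑ) z * ρ z ≤
      (10368 * mixedNorm q' r' t F) * N ρ := by
  have hq1 : 1 ≤ q' := by
    rw [← ENNReal.inv_le_one, ← hqq]
    exact le_add_self
  have hq't : q' ≠ ∞ := by
    rintro rfl
    have h1 : q = 1 := by simpa using hqq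
    rw [h1, div_one] at hadm
    have : (3 : ℝ≥0∞) ≤ 1 := hadm ▸ le_self_add
    norm_num at this
  obtain ⟨L, M, Z, hL, hM, hZ, hLM, hLfin, hduh, hduh0, hum⟩ := exists_measurable_duhamel F
  have hpos : MeasurableSet {z : ℝ × E2 | t < z.1} :=
    measurableSet_lt measurable_const measurable_fst
  have hIm : Measurable fun p => ∫⁻ τ', ‖L (p, τ')‖ₑ := hL.enorm.lintegral_prod_right'
  set Q : ℕ → Set (ℝ × E2) := fun n => (M ∩ {z | t < z.1}) ∩
    (Metric.closedBall 0 n ∩ {p | ∫⁻ τ', ‖L (p, τ')‖ₑ ≤ n}) with hQ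
  have hQmeas : ∀ n, MeasurableSet (Q n) := fun n => (hM.inter hpos).inter
    (measurableSet_closedBall.inter (measurableSet_le hIm measurable_const))
  have hQmono : Monotone Q := fun m n hmn z hz => by
    refine ⟨hz.1, Metric.closedBall_subset_closedBall (by exact_mod_cast hmn) hz.2.1, ?_⟩
    exact le_trans (show ∫⁻ τ', ‖L (z, τ')‖ₑ ≤ m from hz.2.2) (by exact_mod_cast hmn)
  refine lintegral_mul_le_of_truncation hN.mono (hum.enorm.indicator hpos) hQmeas hQmono
    (fun z hz => ?_) (fun n σ hσ hσn hσ0 => ?_) hρ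
  · have hzt : z ∈ {z : ℝ × E2 | t < z.1} := Set.mem_of_indicator_ne_zero hz
    have hzM : z ∈ M := by
      by_contra h
      rw [Set.indicator_of_mem hzt, hduh0 z h] at hz
      simp at hz
    obtain ⟨n₁, hn₁⟩ := exists_nat_ge ‖z‖
    obtain ⟨n₂, hn₂⟩ := ENNReal.exists_nat_gt (hLfin z hzM).ne
    refine ⟨max n₁ n₂, ⟨hzM, hzt⟩, ?_, ?_⟩
    · rw [mem_closedBall_zero_iff]
      exact hn₁.trans (by exact_mod_cast le_max_left _ _)
    · exact hn₂.le.trans (by exact_mod_cast le_max_right n₁ n₂)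
  set u := duhamel F with hu
  set ψ := dualPhase u σ with hψ
  have hψm : Measurable ψ := measurable_dualPhase hum hσ
  have hψ0 : ∀ z ∉ Q n, ψ z = 0 := fun z hz => by simp [hψ, dualPhase, hσ0 z hz]
  have hψi : Integrable ψ := integrable_of_enorm_le_natCast hψm (n := n)
    (s := Metric.closedBall 0 n) measure_closedBall_lt_top.ne
    (fun z => (enorm_dualPhase_le _ _ z).trans (hσn z)) fun z hz => hψ0 z fun h => hz h.2.1
  have hψfin : ∫⁻ z, ‖ψ z‖ₑ ≠ ∞ := hψi.2.ne
  have hψI : ∀ z, ‖ψ z‖ₑ * ∫⁻ τ', ‖L (z, τ')‖ₑ ≤ ‖ψ z‖ₑ * n := fun z => by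
    by_cases hz : z ∈ Q n
    · gcongr
      exact hz.2.2
    · simp [hψ0 z hz]
  have hprod : Integrable (fun p : (ℝ × E2) × ℝ => ψ p.1 * L p)
      ((volume : Measure (ℝ × E2)).prod volume) := by
    have hm : Measurable fun p : (ℝ × E2) × ℝ => ψ p.1 * L p :=
      (hψm.comp measurable_fst).mul hL
    refine ⟨hm.aestronglyMeasurable, ?_⟩
    rw [hasFiniteIntegral_iff_enorm, lintegral_prod _ hm.enorm.aemeasurable]
    simp only [enorm_mul]
    calc ∫⁻ z, ∫⁻ τ', ‖ψ z‖ₑ * ‖L (z, τ')‖ₑ = ∫⁻ z, ‖ψ z‖ₑ * ∫⁻ τ', ‖L (z, τ')‖ₑ :=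
          lintegral_congr fun z => lintegral_const_mul' _ _ (by finiteness)
      _ ≤ ∫⁻ z, ‖ψ z‖ₑ * n := lintegral_mono hψI
      _ = (∫⁻ z, ‖ψ z‖ₑ) * n := lintegral_mul_const _ hψm.enorm
      _ < ∞ := by finiteness
  have huψ : ∀ z, u z * ψ z = ∫ τ', ψ z * L (z, τ') := fun z => by
    by_cases hz : z ∈ Q n
    · rw [integral_const_mul, hduh z hz.1.1, mul_comm]
    · simp [hψ0 z hz]
  have huψi : Integrable fun z => u z * ψ z := by
    simp_rw [huψ]
    exact hprod.integral_prod_left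
  set H : ℝ → ℂ := fun τ' => ∫ z, ψ z * L (z, τ') with hH
  have hHm : Measurable H :=
    (((hψm.comp measurable_fst).mul hL).stronglyMeasurable.integral_prod_left
      (f := fun z τ' => ψ z * L (z, τ'))).measurable
  set Λ : Set (ℝ × ℝ) := {p | p.1 < p.2} with hΛ
  have hΛm : MeasurableSet Λ := measurableSet_lt measurable_fst measurable_snd
  have hHeq : ∀ τ' ∉ Z, H τ' = ∫ z : ℝ × E2,
      ψ z * (Λ.indicator (fun _ => (1 : ℂ)) (z.1, τ') * Vop (z.1 - τ') (F τ') z.2) := by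
    intro τ' hτ'
    refine integral_congr_ae (Filter.Eventually.of_forall fun z => ?_)
    by_cases hz : z ∈ Q n
    · dsimp only
      rw [hLM z hz.1.1 τ' hτ']
      by_cases h : z.1 < τ'
      · rw [Set.indicator_of_mem (Set.mem_Ioi.2 h), Set.indicator_of_mem (show (z.1, τ') ∈ Λ from h),
          one_mul]
      · rw [Set.indicator_of_notMem (fun h' => h (Set.mem_Ioi.1 h')),
          Set.indicator_of_notMem (show (z.1, τ') ∉ Λ from h), zero_mul]
    · simp [hψ0 z hz]
  have hZae : ∀ᵐ τ', τ' ∉ Z := measure_eq_zero_iff_ae_notMem.1 hZ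
  have hHt : ∀ᵐ τ', ‖H τ'‖ₑ = (Set.Ioi t).indicator (fun τ' => ‖H τ'‖ₑ) τ' := by
    filter_upwards [hZae] with τ' hτ'
    by_cases h : t < τ'
    · rw [Set.indicator_of_mem (Set.mem_Ioi.2 h)]
    · rw [Set.indicator_of_notMem (fun h' => h (Set.mem_Ioi.1 h')), hHeq τ' hτ',
        integral_eq_zero_of_ae, enorm_zero]
      refine Filter.Eventually.of_forall fun z => ?_
      by_cases hz : z ∈ Q n
      · have h1 : ¬ z.1 < τ' := fun h2 => h (lt_trans (show t < z.1 from hz.1.2) h2)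
        dsimp only
        rw [Set.indicator_of_notMem (show (z.1, τ') ∉ Λ from h1)]
        simp
      · simp [hψ0 z hz]
  obtain ⟨g, hgm, hge, hgn⟩ := hN.exists_liminf_le hadm hr hΛm hψm hψi
  calc ∫⁻ z, {z : ℝ × E2 | t < z.1}.indicator (fun z => ‖u z‖ₑ) z * σ z
      ≤ ∫⁻ z, ‖u z‖ₑ * σ z := by
        refine lintegral_mono fun z => ?_
        dsimp only
        gcongr
        exact Set.indicator_le_self _ _ _
    _ = ‖∫ τ', H τ'‖ₑ := by
        rw [lintegral_enorm_mul_eq (fun z => ((hσn z).trans_lt (by finiteness)).ne) huψi]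
        simp_rw [← hψ, huψ]
        rw [integral_integral_swap (f := fun z τ' => ψ z * L (z, τ')) hprod]
    _ ≤ ∫⁻ τ', ‖H τ'‖ₑ := enorm_integral_le_lintegral_enorm _
    _ = ∫⁻ τ' in Set.Ioi t, ‖H τ'‖ₑ := by
        rw [lintegral_congr_ae hHt, lintegral_indicator measurableSet_Ioi]
    _ ≤ mixedNorm q' r' t F * (10368 * N σ) := by
        refine lintegral_le_mul_of_le_mul hq1 hq't hqq (a := fun τ' => eLpNorm (F τ') r' volume)
          hHm.enorm hgm (ae_restrict_of_ae ?_) hX (ENNReal.mul_ne_top (by finiteness)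
            (hN.ne_top n σ hσn fun z hz => hσ0 z fun h => hz h.2.1)) ?_ ?_
        · filter_upwards [hZae, hge] with τ' hτ' hgτ hfin
          rw [hHeq τ' hτ']
          refine (enorm_integral_mul_Vop_le hrr hΛm hψm hψi (F τ') τ' hfin).trans ?_
          gcongr
        · rw [mixedNorm, lqNormIoi, if_neg hq't]
        · refine (eLpNorm_mono_measure g Measure.restrict_le_self).trans (hgn.trans ?_)
          gcongr
          exact hN.mono fun z => enorm_dualPhase_le _ _ z
    _ = _ := by ring

theorem lqNormIoi_le_eLpNorm {q : ℝ≥0∞} (hq0 : q ≠ 0) {t : ℝ} {h g : ℝ → ℝ≥0∞}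
    (hle : ∀ᵐ τ ∂volume.restrict (Set.Ioi t), h τ ≤ g τ) :
    lqNormIoi q t h ≤ eLpNorm g q volume := by
  refine le_trans ?_ (eLpNorm_mono_measure g (Measure.restrict_le_self (s := Set.Ioi t)))
  by_cases hq : q = ∞
  · subst hq
    rw [lqNormIoi, if_pos rfl, eLpNorm_exponent_top]
    exact _root_.essSup_mono_ae hle
  · rw [lqNormIoi, if_neg hq, eLpNorm_eq_lintegral_rpow_enorm_toReal hq0 hq]
    gcongr ?_ ^ _
    refine lintegral_mono_ae ?_
    filter_upwards [hle] with τ hτ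
    rw [enorm_eq_self]
    gcongr

theorem mixedNorm_duhamel_le {q₁ r₁ q₂ r₂ q₂' r₂' : ℝ≥0∞}
    (hadm₁ : 3 / q₁ + 2 / r₁ = 1) (hr₁ : 2 ≤ r₁) (hadm₂ : 3 / q₂ + 2 / r₂ = 1) (hr₂ : 2 ≤ r₂)
    (hq₂' : q₂⁻¹ + q₂'⁻¹ = 1) (hr₂' : r₂⁻¹ + r₂'⁻¹ = 1) {t : ℝ} {F : ℝ → E2 → ℂ}
    (hX : mixedNorm q₂' r₂' t F ≠ ∞) :
    mixedNorm q₁ r₁ t (fun τ x => duhamel F (τ, x)) ≤ 20736 * mixedNorm q₂' r₂' t F := by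
  have hpos : MeasurableSet {z : ℝ × E2 | t < z.1} :=
    measurableSet_lt measurable_const measurable_fst
  obtain ⟨_, _, _, _, _, _, _, _, _, _, hum⟩ := exists_measurable_duhamel F
  set a : ℝ × E2 → ℝ≥0∞ := {z : ℝ × E2 | t < z.1}.indicator (fun z => ‖duhamel F z‖ₑ) with ha
  have ham : Measurable a := hum.enorm.indicator hpos
  have h3 : ∫⁻ τ, essSup (fun x => a (τ, x)) volume ^ 3 ≤ (20736 * mixedNorm q₂' r₂' t F) ^ 3 := by
    refine (lintegral_essSup_cube_le_of_dual ham fun ρ hρ =>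
      lintegral_enorm_duhamel_mul_le isStrichartzNorm_normL32L1 hadm₂ hr₂ hq₂' hr₂' hX hρ).trans_eq ?_
    rw [← mul_assoc]
    norm_num
  have h2 : ∀ᵐ τ : ℝ, ∫⁻ x, a (τ, x) ^ 2 ≤ (20736 * mixedNorm q₂' r₂' t F) ^ 2 := by
    filter_upwards [ae_lintegral_sq_le_of_dual ham fun ρ hρ =>
      lintegral_enorm_duhamel_mul_le isStrichartzNorm_normL1L2 hadm₂ hr₂ hq₂' hr₂' hX hρ] with τ hτ
    refine hτ.trans ?_
    gcongr
    norm_num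
  set W : ℝ × E2 → ℂ := {z : ℝ × E2 | t < z.1}.indicator (duhamel F) with hW
  have hWa : ∀ z, ‖W z‖ₑ = a z := fun z => by
    by_cases hz : z ∈ {z : ℝ × E2 | t < z.1}
    · rw [hW, ha, Set.indicator_of_mem hz, Set.indicator_of_mem hz]
    · rw [hW, ha, Set.indicator_of_notMem hz, Set.indicator_of_notMem hz, enorm_zero]
  have hWm : Measurable W := hum.indicator hpos
  obtain ⟨g, _, hge, hgn⟩ := exists_eLpNorm_section_le hadm₁ hr₁ hWm
    (B := 20736 * mixedNorm q₂' r₂' t F) (by simpa only [hWa] using h2) (by simpa only [hWa] using h3)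
  have hq0 : q₁ ≠ 0 := by
    rcases admissible_cases hadm₁ with h | h
    · rw [h.1]; exact ENNReal.top_ne_zero
    · exact h.1
  refine (lqNormIoi_le_eLpNorm hq0 ?_).trans hgn
  rw [ae_restrict_iff' measurableSet_Ioi]
  filter_upwards [hge] with τ hτ htτ
  refine le_of_eq_of_le ?_ hτ
  congr 1 with x
  rw [hW, Set.indicator_of_mem (show (τ, x) ∈ {z : ℝ × E2 | t < z.1} from htτ)]

/-- Lemma 2.1 (ii): the (retarded) Strichartz estimate for admissible pairs
`3/qⱼ + 2/rⱼ = 1`, `2 ≤ rⱼ ≤ ∞`: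
`‖∫_τ^∞ V(τ-τ')F(τ')dτ'‖_{L^{q₁}(t,∞;L^{r₁})} ≤ C ‖F‖_{L^{q₂'}(t,∞;L^{r₂'})}`. -/
theorem strichartz_retarded (q₁ r₁ q₂ r₂ q₂' r₂' : ℝ≥0∞)
    (hadm₁ : 3 / q₁ + 2 / r₁ = 1) (hr₁ : 2 ≤ r₁)
    (hadm₂ : 3 / q₂ + 2 / r₂ = 1) (hr₂ : 2 ≤ r₂)
    (hq₂' : q₂⁻¹ + q₂'⁻¹ = 1) (hr₂' : r₂⁻¹ + r₂'⁻¹ = 1) :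
    ∃ C : ℝ, 0 < C ∧ ∀ t : ℝ, ∀ F : ℝ → E2 → ℂ,
      mixedNorm q₁ r₁ t (fun τ x => ∫ τ' in Set.Ioi τ, Vop (τ - τ') (F τ') x) ≤
        ENNReal.ofReal C * mixedNorm q₂' r₂' t F := by
  refine ⟨20736, by norm_num, fun t F => ?_⟩
  have hC : ENNReal.ofReal 20736 = 20736 := by simp
  rw [hC]
  by_cases hX : mixedNorm q₂' r₂' t F = ∞
  · rw [hX, ENNReal.mul_top (by norm_num)]
    exact le_top
  · exact mixedNorm_duhamel_le hadm₁ hr₁ hadm₂ hr₂ hq₂' hr₂' hX
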